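/- arXiv:1011.5339 — 4 statements merged into one kernel-verified Lean document; each statement's English description precedes it below -/
import Mathlib

section
/- Assume the Riemann hypothesis. Then for every fixed real σ < 1/2, the set {ζ(σ+it) : t ∈ ℝ} is not dense in ℂ. -/
open Complex Filter Topology Finset

/-- `y ↦ log (y / |y + it|)` is concave on the positive reals. -/
lemma concaveOn_log_sub_half_log_sq_add_sq (t : ℝ) :
    ConcaveOn ℝ (Set.Ioi 0) fun y : ℝ => Real.log y - Real.log (y ^ 2 + t ^ 2) / 2 := by
  have hd : ∀ y ∈ Set.Ioi (0 : ℝ), HasDerivAt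
      (fun y : ℝ => Real.log y - Real.log (y ^ 2 + t ^ 2) / 2) (t ^ 2 / (y * (y ^ 2 + t ^ 2))) y := by
    intro y hy
    have hy : 0 < y := hy
    have hpos : y ^ 2 + t ^ 2 ≠ 0 := by positivity
    refine ((Real.hasDerivAt_log hy.ne').sub
      ((((hasDerivAt_pow 2 y).add_const (t ^ 2)).log hpos).div_const 2)).congr_deriv ?_
    push_cast
    field_simp
    ring
  refine AntitoneOn.concaveOn_of_deriv (convex_Ioi 0)
    (fun y hy => (hd y hy).continuousAt.continuousWithinAt) ?_ ?_
  · rw [interior_Ioi]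
    exact fun y hy => (hd y hy).differentiableAt.differentiableWithinAt
  · rw [interior_Ioi]
    intro x hx y hy hxy
    have hx' : 0 < x := hx
    have hy' : 0 < y := hy
    rw [(hd x hx).deriv, (hd y hy).deriv]
    gcongr

lemma div_norm_eq_exp {y : ℝ} (hy : 0 < y) (t : ℝ) :
    y / ‖(y : ℂ) + t * I‖ = Real.exp (Real.log y - Real.log (y ^ 2 + t ^ 2) / 2) := by
  rw [Real.exp_sub, Real.exp_log hy, Complex.norm_add_mul_I, Real.sqrt_eq_rpow,
    Real.rpow_def_of_pos (by positivity)]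
  ring_nf

lemma div_norm_logConcave {y a : ℝ} (hy : 0 < y) (ha : 0 ≤ a) (ha1 : a ≤ 1) (t : ℝ) :
    (y / ‖(y : ℂ) + t * I‖) ^ (1 - a) * ((y + 1) / ‖((y + 1 : ℝ) : ℂ) + t * I‖) ^ a ≤
      (y + a) / ‖((y + a : ℝ) : ℂ) + t * I‖ := by
  rw [div_norm_eq_exp hy, div_norm_eq_exp (by positivity), div_norm_eq_exp (by positivity),
    ← Real.exp_mul, ← Real.exp_mul, ← Real.exp_add, Real.exp_le_exp]
  have h := (concaveOn_log_sub_half_log_sq_add_sq t).2 (x := y) (y := y + 1) hy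
    (show 0 < y + 1 by positivity) (sub_nonneg.2 ha1) ha (by ring)
  simp only [smul_eq_mul] at h
  rw [show (1 - a) * y + a * (y + 1) = y + a by ring] at h
  linarith

lemma div_norm_mono {x y : ℝ} (hx : 0 < x) (hxy : x ≤ y) (t : ℝ) :
    x / ‖(x : ℂ) + t * I‖ ≤ y / ‖(y : ℂ) + t * I‖ := by
  have hy : 0 < y := hx.trans_le hxy
  rw [Complex.norm_add_mul_I, Complex.norm_add_mul_I, div_le_div_iff₀ (by positivity) (by positivity)]
  apply le_of_sq_le_sq _ (by positivity)
  rw [mul_pow, mul_pow, Real.sq_sqrt (by positivity), Real.sq_sqrt (by positivity)]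
  nlinarith [mul_self_le_mul_self hx.le hxy, sq_nonneg t]

/-- The Euler limit formula for `|Γ(x + it)| / Γ(x)`. -/
lemma tendsto_prod_div_norm {x : ℝ} (hx : 0 < x) (t : ℝ) :
    Tendsto (fun n : ℕ => ∏ j ∈ range (n + 1), ((x + j) / ‖((x + j : ℝ) : ℂ) + t * I‖)) atTop
      (𝓝 (‖Gamma (x + t * I)‖ / Real.Gamma x)) := by
  have h := (GammaSeq_tendsto_Gamma (x + t * I)).norm.div (Real.GammaSeq_tendsto_Gamma x)
    (Real.Gamma_pos_of_pos hx).ne'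
  refine h.congr' ?_
  filter_upwards [eventually_gt_atTop 0] with n hn
  have hn' : (0 : ℝ) < n := by exact_mod_cast hn
  have h1 : ‖(n : ℂ) ^ ((x : ℂ) + t * I)‖ = (n : ℝ) ^ x := by
    rw [← ofReal_natCast, norm_cpow_eq_rpow_re_of_pos hn']
    simp
  have h2 : ∀ j : ℕ, (x : ℂ) + t * I + j = ((x + j : ℝ) : ℂ) + t * I := by
    intro j; push_cast; ring
  have h3 : (n : ℝ) ^ x ≠ 0 := by positivity
  have h4 : (n.factorial : ℝ) ≠ 0 := by positivity
  simp only [Pi.div_apply, GammaSeq, Real.GammaSeq, norm_div, norm_mul, h1, norm_prod, h2,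
    RCLike.norm_natCast, prod_div_distrib]
  have h5 : ∏ j ∈ range (n + 1), ‖((x + j : ℝ) : ℂ) + t * I‖ ≠ 0 := by
    refine prod_ne_zero_iff.2 fun j _ => ?_
    rw [Complex.norm_add_mul_I]
    positivity
  have h6 : ∏ j ∈ range (n + 1), (x + j) ≠ 0 := prod_ne_zero_iff.2 fun j _ => by positivity
  field_simp

lemma norm_Gamma_div_Gamma_mono {x y : ℝ} (hx : 0 < x) (hxy : x ≤ y) (t : ℝ) :
    ‖Gamma (x + t * I)‖ / Real.Gamma x ≤ ‖Gamma (y + t * I)‖ / Real.Gamma y := by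
  refine le_of_tendsto_of_tendsto' (tendsto_prod_div_norm hx t)
    (tendsto_prod_div_norm (hx.trans_le hxy) t) fun n => ?_
  exact prod_le_prod (fun j _ => by positivity)
    fun j _ => div_norm_mono (by positivity) (by linarith) t

lemma norm_Gamma_div_Gamma_logConcave {x a : ℝ} (hx : 0 < x) (ha : 0 ≤ a) (ha1 : a ≤ 1) (t : ℝ) :
    (‖Gamma (x + t * I)‖ / Real.Gamma x) ^ (1 - a) *
      (‖Gamma ((x + 1 : ℝ) + t * I)‖ / Real.Gamma (x + 1)) ^ a ≤
      ‖Gamma ((x + a : ℝ) + t * I)‖ / Real.Gamma (x + a) := by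
  refine le_of_tendsto_of_tendsto'
    (((tendsto_prod_div_norm hx t).rpow_const (Or.inr (sub_nonneg.2 ha1))).mul
      ((tendsto_prod_div_norm (x := x + 1) (by positivity) t).rpow_const (Or.inr ha)))
    (tendsto_prod_div_norm (x := x + a) (by positivity) t) fun n => ?_
  rw [← Real.finsetProd_rpow _ _ (fun j _ => by positivity),
    ← Real.finsetProd_rpow _ _ (fun j _ => by positivity), ← prod_mul_distrib]
  refine prod_le_prod (fun j _ => by positivity) fun j _ => ?_
  rw [add_right_comm x 1, add_right_comm x a]
  exact div_norm_logConcave (by positivity) ha ha1 t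

/-- A Stirling-type lower bound for the growth of `|Γ(x + a + it)|` relative to `|Γ(x + it)|`. -/
lemma rpow_mul_norm_Gamma_le {x a t : ℝ} (hx : 0 < x) (ha : 0 ≤ a) (ha1 : a ≤ 1) (ht : 0 < t) :
    (t / x) ^ a * (‖Gamma (x + t * I)‖ / Real.Gamma x) ≤
      ‖Gamma ((x + a : ℝ) + t * I)‖ / Real.Gamma (x + a) := by
  refine le_trans ?_ (norm_Gamma_div_Gamma_logConcave hx ha ha1 t)
  have hne : (x : ℂ) + t * I ≠ 0 := by
    rw [← norm_ne_zero_iff, Complex.norm_add_mul_I]; positivity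
  have hG : 0 < Real.Gamma x := Real.Gamma_pos_of_pos hx
  have hGt : 0 < ‖Gamma (x + t * I)‖ := norm_pos_iff.2 (Gamma_ne_zero_of_re_pos (by simpa))
  have hrec : ‖Gamma ((x + 1 : ℝ) + t * I)‖ / Real.Gamma (x + 1) =
      ‖(x : ℂ) + t * I‖ / x * (‖Gamma (x + t * I)‖ / Real.Gamma x) := by
    rw [Real.Gamma_add_one hx.ne', show ((x + 1 : ℝ) : ℂ) + t * I = x + t * I + 1 by
      push_cast; ring, Gamma_add_one _ hne, norm_mul]
    field_simp
  rw [hrec, Real.mul_rpow (by positivity) (by positivity), mul_left_comm,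
    ← Real.rpow_add (by positivity), sub_add_cancel, Real.rpow_one]
  gcongr
  rw [Complex.norm_add_mul_I]
  exact Real.le_sqrt_of_sq_le (by nlinarith)

lemma norm_Gamma_half_sq (t : ℝ) :
    ‖Gamma ((1 / 2 : ℝ) + t * I)‖ ^ 2 = Real.pi / Real.cosh (Real.pi * t) := by
  have h := Gamma_mul_Gamma_one_sub ((1 / 2 : ℝ) + t * I)
  have hc : (1 : ℂ) - ((1 / 2 : ℝ) + t * I) = starRingEnd ℂ ((1 / 2 : ℝ) + t * I) := by
    rw [map_add, map_mul, conj_ofReal, conj_ofReal, conj_I]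
    push_cast
    ring
  rw [hc, Gamma_conj, mul_conj, normSq_eq_norm_sq,
    show (Real.pi : ℂ) * ((1 / 2 : ℝ) + t * I) = (Real.pi * t : ℝ) * I + Real.pi / 2 by
      push_cast; ring, sin_add_pi_div_two, cos_mul_I, ← ofReal_cosh] at h
  exact_mod_cast h

lemma sinh_le_norm_cos (x y : ℝ) : |Real.sinh y| ≤ ‖cos (x + y * I)‖ := by
  rw [cos_add_mul_I, ← ofReal_cosh, ← ofReal_sinh, ← ofReal_cos, ← ofReal_sin, ← ofReal_mul,
    ← ofReal_mul, sub_eq_add_neg, ← neg_mul, ← ofReal_neg, Complex.norm_add_mul_I]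
  apply Real.le_sqrt_of_sq_le
  rw [sq_abs]
  nlinarith [Real.cosh_sq y, Real.sin_sq_add_cos_sq x, sq_nonneg (Real.cos x)]

lemma exists_rpow_le_norm_Gamma_mul_cos {σ : ℝ} (hσ : 1 / 2 < σ) :
    ∃ c > (0 : ℝ), ∃ δ > (0 : ℝ), ∀ t : ℝ, 1 ≤ t →
      c * t ^ δ ≤ ‖Gamma (σ + t * I) * cos (Real.pi * (σ + t * I) / 2)‖ := by
  set a := min (σ - 1 / 2) 1 with ha
  have ha0 : 0 < a := lt_min (by linarith) one_pos
  have ha1 : a ≤ 1 := min_le_right _ _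
  have haσ : 1 / 2 + a ≤ σ := by linarith [min_le_left (σ - 1 / 2) 1]
  have hGσ : 0 < Real.Gamma σ := Real.Gamma_pos_of_pos (by linarith)
  have hGh : 0 < Real.Gamma (1 / 2) := Real.Gamma_pos_of_pos (by norm_num)
  refine ⟨Real.Gamma σ / Real.Gamma (1 / 2), by positivity, a, ha0, fun t ht => ?_⟩
  have ht0 : 0 < t := by linarith
  have h1 := (rpow_mul_norm_Gamma_le (x := 1 / 2) (by norm_num) ha0.le ha1 ht0).trans
    (norm_Gamma_div_Gamma_mono (by positivity) haσ t)
  have h2 : t ^ a ≤ (t / (1 / 2)) ^ a := by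
    gcongr
    linarith
  have hs : 1 ≤ Real.sinh (Real.pi * t / 2) := by
    have := Real.self_le_sinh_iff.2 (show 0 ≤ Real.pi * t / 2 by positivity)
    nlinarith [Real.pi_gt_three]
  have h3 : 1 ≤ ‖Gamma ((1 / 2 : ℝ) + t * I)‖ * Real.sinh (Real.pi * t / 2) := by
    apply le_of_sq_le_sq _ (by positivity)
    have hc : Real.cosh (Real.pi * t) = 1 + 2 * Real.sinh (Real.pi * t / 2) ^ 2 := by
      rw [show Real.pi * t = 2 * (Real.pi * t / 2) by ring, Real.cosh_two_mul, Real.cosh_sq]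
      ring_nf
    rw [mul_pow, norm_Gamma_half_sq, hc, div_mul_eq_mul_div, le_div_iff₀ (by positivity)]
    nlinarith [Real.pi_gt_three]
  have h4 : Real.sinh (Real.pi * t / 2) ≤ ‖cos (Real.pi * (σ + t * I) / 2)‖ := by
    refine (le_abs_self _).trans ((sinh_le_norm_cos (Real.pi * σ / 2) _).trans_eq ?_)
    congr 2
    push_cast
    ring
  rw [le_div_iff₀ hGσ] at h1
  rw [norm_mul]
  calc Real.Gamma σ / Real.Gamma (1 / 2) * t ^ a
      ≤ Real.Gamma σ / Real.Gamma (1 / 2) * (t / (1 / 2)) ^ a *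
        (‖Gamma ((1 / 2 : ℝ) + t * I)‖ * Real.sinh (Real.pi * t / 2)) := by
        rw [← mul_one (Real.Gamma σ / Real.Gamma (1 / 2) * t ^ a)]
        gcongr
    _ = (t / (1 / 2)) ^ a * (‖Gamma ((1 / 2 : ℝ) + t * I)‖ / Real.Gamma (1 / 2)) * Real.Gamma σ *
        Real.sinh (Real.pi * t / 2) := by ring
    _ ≤ _ := by gcongr

/-- A nonvanishing holomorphic function on a disc has a holomorphic logarithm. -/
lemma exists_log_on_ball {g : ℂ → ℂ} {R : ℝ} (hR : 0 < R)
    (hg : DifferentiableOn ℂ g (Metric.ball 0 R)) (hne : ∀ z ∈ Metric.ball (0 : ℂ) R, g z ≠ 0)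
    (h0 : g 0 = 1) :
    ∃ L : ℂ → ℂ, DifferentiableOn ℂ L (Metric.ball 0 R) ∧ L 0 = 0 ∧
      ∀ z ∈ Metric.ball (0 : ℂ) R, exp (L z) = g z := by
  have hO : IsOpen (Metric.ball (0 : ℂ) R) := Metric.isOpen_ball
  obtain ⟨L, hL0, hL⟩ := ((hg.deriv hO).div hg hne).isExactOn_ball.with_val_at 0 0
  refine ⟨L, fun z hz => (hL z hz).differentiableAt.differentiableWithinAt, hL0, fun z hz => ?_⟩
  have hd : ∀ w ∈ Metric.ball (0 : ℂ) R, HasDerivAt (fun w => exp (-L w) * g w) 0 w := by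
    intro w hw
    refine ((hL w hw).neg.cexp.mul
      (hg.differentiableAt (hO.mem_nhds hw)).hasDerivAt).congr_deriv ?_
    have := hne w hw
    simp only [Pi.div_apply]
    field_simp
    ring
  have hconst := (convex_ball (0 : ℂ) R).is_const_of_fderivWithin_eq_zero (𝕜 := ℂ)
    (fun w hw => (hd w hw).differentiableAt.differentiableWithinAt)
    (fun w hw => by
      rw [fderivWithin_of_isOpen hO hw]
      ext
      simpa using (hd w hw).deriv) hz (Metric.mem_ball_self hR)
  simp only [hL0, h0, neg_zero, exp_zero, mul_one] at hconst
  rw [exp_neg] at hconst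
  field_simp [exp_ne_zero] at hconst
  exact hconst.symm

/-- **Hadamard three-circles theorem** for functions holomorphic on a disc. -/
lemma norm_le_three_circles {f : ℂ → ℂ} {R r₁ r₃ a b : ℝ} (hr₁ : 0 < r₁) (h13 : r₁ < r₃)
    (h3R : r₃ < R) (hf : DifferentiableOn ℂ f (Metric.ball 0 R))
    (ha : ∀ w, ‖w‖ = r₁ → ‖f w‖ ≤ a) (hb : ∀ w, ‖w‖ ≤ r₃ → ‖f w‖ ≤ b) {w : ℂ}
    (hw₁ : r₁ ≤ ‖w‖) (hw₃ : ‖w‖ ≤ r₃) :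
    ‖f w‖ ≤ a ^ (1 - (Real.log ‖w‖ - Real.log r₁) / (Real.log r₃ - Real.log r₁)) *
      b ^ ((Real.log ‖w‖ - Real.log r₁) / (Real.log r₃ - Real.log r₁)) := by
  have hr₃ : 0 < r₃ := hr₁.trans h13
  have hw0 : 0 < ‖w‖ := hr₁.trans_le hw₁
  have hexp : exp (log w) = w := exp_log (norm_pos_iff.1 hw0)
  have hclosed : ∀ z ∈ HadamardThreeLines.verticalClosedStrip (Real.log r₁) (Real.log r₃),
      ‖exp z‖ ≤ r₃ := by
    intro z hz
    rw [norm_exp, ← Real.exp_log hr₃]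
    exact Real.exp_le_exp.2 hz.2
  have h := HadamardThreeLines.norm_le_interp_of_mem_verticalClosedStrip'
    (f := fun z => f (exp z)) (z := log w) (a := a) (b := b)
    (Real.log_lt_log hr₁ h13) ?_ ?_ ?_ ?_ ?_
  · simpa only [hexp, log_re] using h
  · exact ⟨by simpa only [log_re] using Real.log_le_log hr₁ hw₁,
      by simpa only [log_re] using Real.log_le_log hw0 hw₃⟩
  · apply DifferentiableOn.diffContOnCl
    refine hf.comp differentiable_exp.differentiableOn fun z hz => ?_
    have hz' : z ∈ HadamardThreeLines.verticalClosedStrip (Real.log r₁) (Real.log r₃) :=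
      closure_minimal (Set.preimage_mono Set.Ioo_subset_Icc_self)
        (isClosed_Icc.preimage continuous_re) hz
    exact mem_ball_zero_iff.2 ((hclosed z hz').trans_lt h3R)
  · refine ⟨b, ?_⟩
    rintro _ ⟨z, hz, rfl⟩
    exact hb _ (hclosed z hz)
  · intro z hz
    exact ha _ (by rw [norm_exp, show z.re = Real.log r₁ from hz, Real.exp_log hr₁])
  · intro z hz
    exact hb _ (by rw [norm_exp, show z.re = Real.log r₃ from hz, Real.exp_log hr₃])

/-- If a holomorphic function on a disc vanishes at the centre and has real part at most `M`
there, and at most `B` on a smaller disc, then on compact subdiscs it is bounded by a power of `M`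
with exponent less than `1`. -/
lemma exists_norm_le_rpow_of_re_le {R ρ r B : ℝ} (hρ : 0 < ρ) (hr : 0 < r) (hrR : r < R)
    (hρR : ρ ≤ R) (hB : 0 < B) :
    ∃ K > 0, ∃ θ < (1 : ℝ), ∀ M > 0, ∀ L : ℂ → ℂ, DifferentiableOn ℂ L (Metric.ball 0 R) →
      L 0 = 0 → (∀ z ∈ Metric.ball (0 : ℂ) R, (L z).re ≤ M) →
      (∀ z ∈ Metric.ball (0 : ℂ) ρ, (L z).re ≤ B) → ∀ w, ‖w‖ = r → ‖L w‖ ≤ K * M ^ θ := by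
  have hR : 0 < R := hr.trans hrR
  set r₁ := min (ρ / 2) (r / 2) with hr₁
  set r₃ := (r + R) / 2 with hr₃
  have h1 : 0 < r₁ := lt_min (by positivity) (by positivity)
  have h1ρ : r₁ < ρ := (min_le_left _ _).trans_lt (by linarith)
  have h1r : r₁ < r := (min_le_right _ _).trans_lt (by linarith)
  have hr3 : r < r₃ := by linarith
  have h3R : r₃ < R := by linarith
  have h3 : 0 < r₃ := hr.trans hr3
  set θ := (Real.log r - Real.log r₁) / (Real.log r₃ - Real.log r₁) with hθ
  have hlog : Real.log r₁ < Real.log r₃ := Real.log_lt_log h1 (h1r.trans hr3)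
  have hθ1 : θ < 1 := by
    rw [hθ, div_lt_one (by linarith)]
    linarith [Real.log_lt_log hr hr3]
  set a := 2 * B * r₁ / (ρ - r₁) with ha
  set k := 2 * r₃ / (R - r₃) with hk
  have ha0 : 0 < a := div_pos (by positivity) (by linarith)
  have hk0 : 0 < k := div_pos (by positivity) (by linarith)
  refine ⟨a ^ (1 - θ) * k ^ θ, by positivity, θ, hθ1, fun M hM L hL hL0 hLM hLB w hw => ?_⟩
  have key := norm_le_three_circles (a := a) (b := k * M) h1 (h1r.trans hr3) h3R hL ?_ ?_
    (hw ▸ h1r.le) (hw ▸ hr3.le)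
  · rwa [hw, ← hθ, Real.mul_rpow hk0.le hM.le, ← mul_assoc] at key
  · intro z hz
    have := borelCaratheodory_zero hB (hL.mono (Metric.ball_subset_ball hρR)) hLB hρ
      (mem_ball_zero_iff.2 (hz ▸ h1ρ)) hL0
    rwa [hz] at this
  · intro z hz
    refine (borelCaratheodory_zero hM hL hLM hR (mem_ball_zero_iff.2 (hz.trans_lt h3R)) hL0).trans ?_
    have h3R' : 0 < R - r₃ := by linarith
    calc 2 * M * ‖z‖ / (R - ‖z‖) ≤ 2 * M * r₃ / (R - r₃) := by gcongr
      _ = k * M := by rw [hk]; ring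

lemma norm_ofReal_cpow_neg {x : ℝ} (hx : 0 < x) (s : ℂ) : ‖(x : ℂ) ^ (-s)‖ = x ^ (-s.re) := by
  rw [norm_cpow_eq_rpow_re_of_pos hx, neg_re]

lemma hasDerivAt_ofReal_cpow_neg {x : ℝ} (hx : 0 < x) (s : ℂ) :
    HasDerivAt (fun y : ℝ => (y : ℂ) ^ (-s)) (-s * (x : ℂ) ^ (-s - 1)) x := by
  have h := (hasDerivAt_id (x : ℂ)).cpow_const (c := -s) (ofReal_mem_slitPlane.2 hx)
  simpa using h.comp_ofReal

/-- The terms of a series that sums to `(s - 1) ζ(s) - 1` in the half-plane `0 < re s`. -/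
noncomputable def zetaTerm (n : ℕ) (s : ℂ) : ℂ :=
  (s - 1) * ((n + 1 : ℝ) : ℂ) ^ (-s) - ((n + 1 : ℝ) : ℂ) ^ (1 - s) + ((n + 2 : ℝ) : ℂ) ^ (1 - s)

lemma norm_cpow_neg_sub_le {s : ℂ} (hs : 0 < s.re) {a x : ℝ} (ha : 0 < a)
    (hx : x ∈ Set.Icc a (a + 1)) :
    ‖(x : ℂ) ^ (-s) - (a : ℂ) ^ (-s)‖ ≤ ‖s‖ * a ^ (-s.re - 1) := by
  have h := (convex_Icc a (a + 1)).norm_image_sub_le_of_norm_hasDerivWithin_le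
    (f := fun y : ℝ => (y : ℂ) ^ (-s)) (f' := fun y : ℝ => -s * (y : ℂ) ^ (-s - 1))
    (C := ‖s‖ * a ^ (-s.re - 1))
    (fun y hy => (hasDerivAt_ofReal_cpow_neg (ha.trans_le hy.1) s).hasDerivWithinAt)
    (fun y hy => ?_) (Set.left_mem_Icc.2 (by linarith)) hx
  · refine h.trans (mul_le_of_le_one_right (by positivity) ?_)
    rw [Real.norm_eq_abs, abs_le]
    constructor <;> linarith [hx.1, hx.2]
  · rw [norm_mul, norm_neg, norm_cpow_eq_rpow_re_of_pos (ha.trans_le hy.1), sub_re, neg_re, one_re]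
    gcongr ?_ * ?_
    exact Real.rpow_le_rpow_of_nonpos ha hy.1 (by linarith)

lemma norm_zetaTerm_le {s : ℂ} (hs : 0 < s.re) (n : ℕ) :
    ‖zetaTerm n s‖ ≤ ‖s - 1‖ * ‖s‖ * (n + 1 : ℝ) ^ (-s.re - 1) := by
  set a : ℝ := n + 1 with ha
  have ha0 : 0 < a := by positivity
  have h := (convex_Icc a (a + 1)).norm_image_sub_le_of_norm_hasDerivWithin_le
    (f := fun y : ℝ => (s - 1) * (a : ℂ) ^ (-s) * y + (y : ℂ) ^ (-(s - 1)))
    (f' := fun y : ℝ => (s - 1) * (a : ℂ) ^ (-s) * 1 + -(s - 1) * (y : ℂ) ^ (-(s - 1) - 1))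
    (C := ‖s - 1‖ * ‖s‖ * a ^ (-s.re - 1))
    (fun y hy => (((hasDerivAt_id (y : ℂ)).comp_ofReal.const_mul _).add
      (hasDerivAt_ofReal_cpow_neg (ha0.trans_le hy.1) (s - 1))).hasDerivWithinAt)
    (fun y hy => ?_) (Set.left_mem_Icc.2 (by linarith)) (Set.right_mem_Icc.2 (by linarith))
  · rw [add_sub_cancel_left, norm_one, mul_one] at h
    refine (congrArg norm ?_).trans_le h
    rw [zetaTerm, ← ha, show (n + 2 : ℝ) = a + 1 by rw [ha]; ring, neg_sub]
    push_cast
    ring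
  · rw [show (s - 1) * (a : ℂ) ^ (-s) * 1 + -(s - 1) * (y : ℂ) ^ (-(s - 1) - 1) =
      -(s - 1) * ((y : ℂ) ^ (-s) - (a : ℂ) ^ (-s)) by
        rw [show -(s - 1) - 1 = -s by ring]; ring, norm_mul, norm_neg, mul_assoc]
    gcongr
    exact norm_cpow_neg_sub_le hs ha0 hy

lemma summable_natCast_add_one_rpow {p : ℝ} (hp : p < -1) :
    Summable fun n : ℕ => (n + 1 : ℝ) ^ p := by
  have := (summable_nat_add_iff 1).2 (Real.summable_nat_rpow.2 hp)
  simpa using this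

lemma differentiable_zetaTerm (n : ℕ) : Differentiable ℂ (zetaTerm n) := by
  have h1 : ((n + 1 : ℝ) : ℂ) ≠ 0 := ofReal_ne_zero.2 (by positivity)
  have h2 : ((n + 2 : ℝ) : ℂ) ≠ 0 := ofReal_ne_zero.2 (by positivity)
  intro s
  unfold zetaTerm
  refine DifferentiableAt.add (.sub (.mul (by fun_prop) ?_) ?_) ?_
  · exact DifferentiableAt.const_cpow (by fun_prop) (Or.inl h1)
  · exact DifferentiableAt.const_cpow (by fun_prop) (Or.inl h1)
  · exact DifferentiableAt.const_cpow (by fun_prop) (Or.inl h2)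

lemma differentiableOn_tsum_zetaTerm :
    DifferentiableOn ℂ (fun s => ∑' n, zetaTerm n s) {s | 0 < s.re} := by
  intro s hs
  have hs : 0 < s.re := hs
  set U : Set ℂ := {z | s.re / 2 < z.re} ∩ Metric.ball 0 (‖s‖ + 1)
  have hU : IsOpen U := (isOpen_lt continuous_const continuous_re).inter Metric.isOpen_ball
  have hsU : s ∈ U := ⟨show s.re / 2 < s.re by linarith, by simp⟩
  refine ((differentiableOn_tsum_of_summable_norm
    (u := fun n : ℕ => (‖s‖ + 2) * (‖s‖ + 1) * (n + 1 : ℝ) ^ (-(s.re / 2) - 1))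
    ((summable_natCast_add_one_rpow (by linarith)).mul_left _)
    (fun n => (differentiable_zetaTerm n).differentiableOn) hU ?_).differentiableAt
      (hU.mem_nhds hsU)).differentiableWithinAt
  rintro n z ⟨hz1, hz2⟩
  have hz1 : s.re / 2 < z.re := hz1
  have hz2 : ‖z‖ < ‖s‖ + 1 := mem_ball_zero_iff.1 hz2
  refine (norm_zetaTerm_le (by linarith) n).trans ?_
  have h1 : ‖z - 1‖ ≤ ‖s‖ + 2 := (norm_sub_le _ _).trans (by rw [norm_one]; linarith)
  gcongr
  linarith [Nat.cast_nonneg (α := ℝ) n]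

lemma tsum_zetaTerm_of_one_lt_re {s : ℂ} (hs : 1 < s.re) :
    ∑' n, zetaTerm n s = (s - 1) * riemannZeta s - 1 := by
  have hsum : Summable fun n : ℕ => ((n + 1 : ℝ) : ℂ) ^ (-s) := by
    refine Summable.of_norm ?_
    simp only [fun n : ℕ => norm_ofReal_cpow_neg (show (0 : ℝ) < n + 1 by positivity) s]
    exact summable_natCast_add_one_rpow (by linarith)
  have hz : riemannZeta s = ∑' n : ℕ, ((n + 1 : ℝ) : ℂ) ^ (-s) := by
    rw [zeta_eq_tsum_one_div_nat_add_one_cpow hs]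
    refine tsum_congr fun n => ?_
    rw [cpow_neg, one_div]
    push_cast
    rfl
  have hlim : Tendsto (fun n : ℕ => ((n + 1 : ℝ) : ℂ) ^ (1 - s)) atTop (𝓝 0) := by
    rw [tendsto_zero_iff_norm_tendsto_zero]
    simp only [fun n : ℕ => norm_cpow_eq_rpow_re_of_pos (show (0 : ℝ) < n + 1 by positivity) (1 - s)]
    have h : Tendsto (fun x : ℝ => x ^ (1 - s).re) atTop (𝓝 0) := by
      have := tendsto_rpow_neg_atTop (y := s.re - 1) (by linarith)
      simpa using this
    exact h.comp (tendsto_atTop_add_const_right _ _ tendsto_natCast_atTop_atTop)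
  have hpart : ∀ N : ℕ, ∑ n ∈ range N, zetaTerm n s =
      (s - 1) * ∑ n ∈ range N, ((n + 1 : ℝ) : ℂ) ^ (-s) - 1 + ((N + 1 : ℝ) : ℂ) ^ (1 - s) := by
    intro N
    induction N with
    | zero => simp
    | succ N ih =>
      rw [sum_range_succ, ih, sum_range_succ, zetaTerm,
        show ((N + 1 : ℕ) : ℝ) + 1 = N + 2 by push_cast; ring]
      ring
  have hs' : Summable fun n => zetaTerm n s := by
    refine Summable.of_norm_bounded ?_ (norm_zetaTerm_le (by linarith))
    exact (summable_natCast_add_one_rpow (by linarith)).mul_left _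
  refine tendsto_nhds_unique hs'.hasSum.tendsto_sum_nat ?_
  simp only [hpart]
  have := (((hsum.hasSum.tendsto_sum_nat).const_mul (s - 1)).sub_const 1).add hlim
  rwa [add_zero, ← hz] at this

lemma tsum_zetaTerm_of_pos_re {s : ℂ} (hs : 0 < s.re) (hs1 : s ≠ 1) :
    ∑' n, zetaTerm n s = (s - 1) * riemannZeta s - 1 := by
  have hO : IsOpen {s : ℂ | 0 < s.re} := isOpen_lt continuous_const continuous_re
  have h1 := differentiableOn_tsum_zetaTerm.analyticOnNhd hO
  have h2 : AnalyticOnNhd ℂ (fun s => riemannZeta₁ s - 1) {s | 0 < s.re} :=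
    (differentiable_riemannZeta₁.sub_const 1).differentiableOn.analyticOnNhd hO
  have hev : (fun s => ∑' n, zetaTerm n s) =ᶠ[𝓝 2] fun s => riemannZeta₁ s - 1 := by
    filter_upwards [(isOpen_lt continuous_const continuous_re).mem_nhds
      (show (2 : ℂ) ∈ {s : ℂ | 1 < s.re} by simp)] with z hz
    have hz : 1 < z.re := hz
    have hz1 : z ≠ 1 := by rintro rfl; simp at hz
    rw [tsum_zetaTerm_of_one_lt_re hz, riemannZeta_eq_inv_sub_mul hz1,
      mul_inv_cancel_left₀ (sub_ne_zero.2 hz1)]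
  have := h1.eqOn_of_preconnected_of_eventuallyEq h2 (convex_halfSpace_re_gt 0).isPreconnected
    (show (2 : ℂ) ∈ {s : ℂ | 0 < s.re} by simp) hev hs
  simp only at this
  rw [this, riemannZeta_eq_inv_sub_mul hs1, mul_inv_cancel_left₀ (sub_ne_zero.2 hs1)]

/-- `ζ` grows at most linearly on the half-plane `1/2 ≤ re s`, away from the real axis. -/
lemma exists_norm_riemannZeta_le :
    ∃ C > (0 : ℝ), ∀ s : ℂ, 1 / 2 ≤ s.re → 1 ≤ |s.im| → ‖riemannZeta s‖ ≤ C * ‖s‖ := by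
  have hsum := summable_natCast_add_one_rpow (p := -(1 / 2) - 1) (by norm_num)
  set S := ∑' n : ℕ, (n + 1 : ℝ) ^ (-(1 / 2) - 1 : ℝ)
  have hS : 0 ≤ S := tsum_nonneg fun n => by positivity
  refine ⟨S + 1, by positivity, fun s hs ht => ?_⟩
  have hs1 : s ≠ 1 := by rintro rfl; norm_num at ht
  have h1 : 1 ≤ ‖s - 1‖ := ht.trans (by simpa using abs_im_le_norm (s - 1))
  have h2 : 1 ≤ ‖s‖ := ht.trans (abs_im_le_norm s)
  have hb : ‖∑' n, zetaTerm n s‖ ≤ ‖s - 1‖ * ‖s‖ * S := by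
    refine tsum_of_norm_bounded (hsum.hasSum.mul_left _) fun n =>
      (norm_zetaTerm_le (by linarith) n).trans ?_
    gcongr
    linarith [Nat.cast_nonneg (α := ℝ) n]
  rw [tsum_zetaTerm_of_pos_re (by linarith) hs1] at hb
  have h3 : ‖s - 1‖ * ‖riemannZeta s‖ ≤ ‖s - 1‖ * ‖s‖ * S + 1 := by
    rw [← norm_mul]
    have := norm_le_norm_sub_add ((s - 1) * riemannZeta s) 1
    rw [norm_one] at this
    linarith
  refine le_of_mul_le_mul_left (h3.trans ?_) (by linarith : 0 < ‖s - 1‖)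
  nlinarith [mul_le_mul h1 h2 zero_le_one (by linarith)]

lemma norm_riemannZeta_le_tsum {p : ℝ} (hp : 1 < p) {s : ℂ} (hs : p ≤ s.re) :
    ‖riemannZeta s‖ ≤ ∑' n : ℕ, (n + 1 : ℝ) ^ (-p) := by
  rw [zeta_eq_tsum_one_div_nat_add_one_cpow (hp.trans_le hs)]
  refine tsum_of_norm_bounded (summable_natCast_add_one_rpow (by linarith)).hasSum fun n => ?_
  rw [one_div, ← cpow_neg, show (n + 1 : ℂ) = ((n + 1 : ℝ) : ℂ) by push_cast; rfl,
    norm_ofReal_cpow_neg (by positivity)]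
  gcongr
  linarith [Nat.cast_nonneg (α := ℝ) n]

lemma one_third_le_norm_riemannZeta {s : ℂ} (hs : 2 ≤ s.re) : 1 / 3 ≤ ‖riemannZeta s‖ := by
  have hterm : ∀ n : ℕ, ‖1 / (n : ℂ) ^ s‖ ≤ 1 / (n : ℝ) ^ 2 := by
    intro n
    rcases n.eq_zero_or_pos with rfl | hn
    · simp [zero_cpow (show s ≠ 0 by rintro rfl; norm_num at hs)]
    · rw [norm_div, norm_one, norm_natCast_cpow_of_pos hn, ← Real.rpow_natCast]
      gcongr
      · exact_mod_cast hn
      · exact_mod_cast hs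
  have hsq := hasSum_zeta_two
  have hsum : Summable fun n : ℕ => 1 / (n : ℂ) ^ s :=
    Summable.of_norm_bounded hsq.summable hterm
  have hz := zeta_eq_tsum_one_div_nat_cpow (s := s) (by linarith)
  have h2 := (hasSum_nat_add_iff' 2).2 hsq
  have h3 : riemannZeta s - 1 = ∑' n : ℕ, 1 / ((n + 2 : ℕ) : ℂ) ^ s := by
    rw [hz, ← hsum.sum_add_tsum_nat_add 2]
    simp [sum_range_succ, zero_cpow (show s ≠ 0 by rintro rfl; norm_num at hs)]
  have h4 : ‖riemannZeta s - 1‖ ≤ Real.pi ^ 2 / 6 - 1 := by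
    rw [h3]
    refine tsum_of_norm_bounded ?_ fun n => hterm (n + 2)
    simpa [sum_range_succ] using h2
  have h5 := norm_sub_norm_le (1 : ℂ) (1 - riemannZeta s)
  rw [sub_sub_cancel, norm_one, norm_sub_rev] at h5
  nlinarith [Real.pi_lt_d2, Real.pi_pos]

lemma riemannZeta_ne_zero_of_half_lt_re (hRH : RiemannHypothesis) {s : ℂ} (hs : 1 / 2 < s.re) :
    riemannZeta s ≠ 0 := by
  intro h
  by_cases hs1 : s = 1
  · exact riemannZeta_one_ne_zero (hs1 ▸ h)
  refine hs.ne' (hRH s h ?_ hs1)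
  rintro ⟨n, rfl⟩
  have : ((-2 * (n + 1) : ℂ)).re = -2 * (n + 1 : ℝ) := by simp
  rw [this] at hs
  linarith [Nat.cast_nonneg (α := ℝ) n]

/-- A sublinear power of a logarithm is eventually dominated by any multiple of `log t`. -/
lemma eventually_log_rpow_le {A K θ ε : ℝ} (hA : 0 < A) (hK : 0 < K) (hθ : θ < 1) (hε : 0 < ε)
    (D : ℝ) :
    ∀ᶠ t : ℝ in atTop, K * Real.log (A * (t + 4)) ^ θ + D ≤ ε * Real.log t := by
  have hM : Tendsto (fun t : ℝ => Real.log (A * (t + 4))) atTop atTop :=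
    Real.tendsto_log_atTop.comp
      ((tendsto_atTop_add_const_right _ _ tendsto_id).const_mul_atTop hA)
  have hpow : Tendsto (fun x : ℝ => x ^ (-(1 - θ))) atTop (𝓝 0) :=
    tendsto_rpow_neg_atTop (by linarith)
  filter_upwards [(hpow.comp hM).eventually (gt_mem_nhds (show 0 < ε / (4 * K) by positivity)),
    hM.eventually_gt_atTop 0, eventually_ge_atTop (A * 5), eventually_ge_atTop 1,
    Real.tendsto_log_atTop.eventually_ge_atTop (2 * D / ε)] with t h1 h2 h3 h4 h5
  simp only [Function.comp_apply] at h1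
  set M := Real.log (A * (t + 4)) with hMdef
  have hM2 : M ≤ 2 * Real.log t := by
    have : A * (t + 4) ≤ t ^ 2 := by nlinarith
    calc M ≤ Real.log (t ^ 2) := Real.log_le_log (by positivity) this
      _ = 2 * Real.log t := by simp
  have hMθ : M ^ θ = M * M ^ (-(1 - θ)) := by
    rw [show M * M ^ (-(1 - θ)) = M ^ (1 : ℝ) * M ^ (-(1 - θ)) by rw [Real.rpow_one],
      ← Real.rpow_add h2]
    ring_nf
  have h6 : K * M ^ θ ≤ ε / 2 * Real.log t := by
    calc K * M ^ θ = K * (M * M ^ (-(1 - θ))) := by rw [hMθ]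
      _ ≤ K * (2 * Real.log t * (ε / (4 * K))) := by
          gcongr
          exact h2.le.trans hM2
      _ = ε / 2 * Real.log t := by field_simp; ring
  rw [div_le_iff₀ hε] at h5
  linarith

/-- Under the Riemann hypothesis, `1 / ζ(σ + it) = O(t ^ ε)` for `σ > 1/2`. -/
lemma eventually_rpow_neg_le_norm_riemannZeta (hRH : RiemannHypothesis) {σ ε : ℝ}
    (hσ : 1 / 2 < σ) (hε : 0 < ε) :
    ∀ᶠ t : ℝ in atTop, t ^ (-ε) ≤ ‖riemannZeta (σ + t * I)‖ := by
  rcases le_or_gt 2 σ with h2 | h2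
  · filter_upwards [(tendsto_rpow_neg_atTop hε).eventually
      (gt_mem_nhds (show (0 : ℝ) < 1 / 3 by norm_num))] with t ht
    exact ht.le.trans (one_third_le_norm_riemannZeta (by simpa using h2))
  obtain ⟨C, hC, hCb⟩ := exists_norm_riemannZeta_le
  set S := ∑' n : ℕ, (n + 1 : ℝ) ^ (-(5 / 4) : ℝ) with hS
  obtain ⟨K, hK, θ, hθ, hL⟩ := exists_norm_le_rpow_of_re_le (R := 3 / 2) (ρ := 3 / 4) (r := 2 - σ)
    (B := |Real.log (3 * S)| + 1) (by norm_num) (by linarith) (by linarith) (by norm_num)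
    (by positivity)
  filter_upwards [eventually_log_rpow_le (A := 3 * C + 1) (by positivity) hK hθ hε (Real.log 3),
    eventually_ge_atTop 3] with t hlog ht
  set c : ℂ := 2 + t * I with hc
  have hcb : 1 / 3 ≤ ‖riemannZeta c‖ := one_third_le_norm_riemannZeta (by simp [hc])
  have hc0 : riemannZeta c ≠ 0 := norm_pos_iff.1 (by linarith)
  have hre : ∀ {w : ℂ} {q : ℝ}, w ∈ Metric.ball (0 : ℂ) q → 2 - q < (c + w).re := by
    intro w q hw
    have h1 := neg_abs_le w.re
    have h2 := (abs_re_le_norm w).trans_lt (mem_ball_zero_iff.1 hw)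
    simp only [hc, add_re, mul_re, re_ofNat, ofReal_re, I_re, ofReal_im, I_im]
    linarith
  have him : ∀ w ∈ Metric.ball (0 : ℂ) (3 / 2), 1 ≤ |(c + w).im| := by
    intro w hw
    have h1 := neg_abs_le w.im
    have h2 := (abs_im_le_norm w).trans_lt (mem_ball_zero_iff.1 hw)
    refine le_trans ?_ (le_abs_self _)
    simp only [hc, add_im, mul_im, im_ofNat, ofReal_re, I_re, ofReal_im, I_im]
    linarith
  have hnorm : ∀ w ∈ Metric.ball (0 : ℂ) (3 / 2), ‖c + w‖ ≤ t + 4 := by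
    intro w hw
    have h1 := norm_add_le c w
    have h2 : ‖c‖ ≤ 2 + t := by
      refine (norm_add_le _ _).trans_eq ?_
      simp [abs_of_nonneg (show 0 ≤ t by linarith)]
    linarith [mem_ball_zero_iff.1 hw]
  have hdiff : DifferentiableOn ℂ (fun w => riemannZeta (c + w) / riemannZeta c)
      (Metric.ball 0 (3 / 2)) := by
    intro w hw
    have hne : c + w ≠ 1 := by
      intro h
      have := him w hw
      rw [h] at this
      norm_num at this
    have hz : DifferentiableAt ℂ (fun w => riemannZeta (c + w)) w :=
      (differentiableAt_riemannZeta hne).comp w (by fun_prop)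
    exact (hz.div_const _).differentiableWithinAt
  obtain ⟨L, hLd, hL0, hLe⟩ := exists_log_on_ball (by norm_num) hdiff
    (fun w hw => div_ne_zero (riemannZeta_ne_zero_of_half_lt_re hRH
      (by linarith [hre hw])) hc0) (by simp [hc0])
  have hLre : ∀ w ∈ Metric.ball (0 : ℂ) (3 / 2), ∀ X : ℝ, ‖riemannZeta (c + w)‖ ≤ X →
      (L w).re ≤ Real.log (3 * X) := by
    intro w hw X hX
    have hn := congrArg norm (hLe w hw)
    rw [norm_exp, norm_div] at hn
    have hle : Real.exp (L w).re ≤ 3 * X := by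
      rw [hn, div_le_iff₀ (by linarith)]
      nlinarith [norm_nonneg (riemannZeta (c + w))]
    exact (Real.le_log_iff_exp_le ((Real.exp_pos _).trans_le hle)).2 hle
  have hbound := hL (Real.log ((3 * C + 1) * (t + 4))) (Real.log_pos (by nlinarith)) L hLd hL0
    (fun w hw => (hLre w hw _ ((hCb _ (by linarith [hre hw]) (him w hw)).trans
      (mul_le_mul_of_nonneg_left (hnorm w hw) hC.le))).trans
        (Real.log_le_log (by positivity) (by nlinarith)))
    (fun w hw => (hLre w (Metric.ball_subset_ball (by norm_num) hw) S
      (norm_riemannZeta_le_tsum (by norm_num) (by linarith [hre hw]))).trans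
        (by linarith [le_abs_self (Real.log (3 * S))]))
    ((σ - 2 : ℝ) : ℂ) (by rw [norm_real, Real.norm_eq_abs, abs_of_neg (by linarith)]; ring)
  have hw : ((σ - 2 : ℝ) : ℂ) ∈ Metric.ball (0 : ℂ) (3 / 2) := by
    rw [mem_ball_zero_iff, norm_real, Real.norm_eq_abs, abs_of_neg (by linarith)]
    linarith
  have hn := congrArg norm (hLe _ hw)
  rw [norm_exp, norm_div, show c + ((σ - 2 : ℝ) : ℂ) = σ + t * I by rw [hc]; push_cast; ring,
    eq_div_iff (by linarith)] at hn
  rw [← hn]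
  have hLlow := (abs_le.1 ((abs_re_le_norm _).trans hbound)).1
  calc t ^ (-ε) = Real.exp (-(ε * Real.log t)) := by
        rw [Real.rpow_def_of_pos (by linarith)]; ring_nf
    _ ≤ Real.exp ((L ((σ - 2 : ℝ) : ℂ)).re - Real.log 3) := Real.exp_le_exp.2 (by linarith)
    _ = Real.exp (L ((σ - 2 : ℝ) : ℂ)).re * (1 / 3) := by
        rw [Real.exp_sub, Real.exp_log (by norm_num)]; ring
    _ ≤ _ := by gcongr

/-- Under the Riemann hypothesis, `|ζ(σ + it)| → ∞` as `t → ∞`, for `σ < 1/2`. -/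
lemma tendsto_norm_riemannZeta_atTop (hRH : RiemannHypothesis) {σ : ℝ} (hσ : σ < 1 / 2) :
    Tendsto (fun t : ℝ => ‖riemannZeta (σ + t * I)‖) atTop atTop := by
  obtain ⟨c, hc, δ, hδ, hG⟩ := exists_rpow_le_norm_Gamma_mul_cos (σ := 1 - σ) (by linarith)
  set k : ℝ := 2 * (2 * Real.pi) ^ (-(1 - σ)) * c with hk
  have hk0 : 0 < k := by positivity
  refine tendsto_atTop_mono' _ ?_ ((tendsto_rpow_atTop (half_pos hδ)).const_mul_atTop hk0)
  filter_upwards [eventually_rpow_neg_le_norm_riemannZeta hRH (σ := 1 - σ) (by linarith)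
    (half_pos hδ), eventually_ge_atTop 1] with t hz ht
  set s : ℂ := (1 - σ : ℝ) + t * I with hs
  have hsim : s.im = t := by simp [hs]
  have hfe := riemannZeta_one_sub (s := s)
    (fun n h => by rw [h] at hsim; simp at hsim; linarith)
    (fun h => by rw [h] at hsim; simp at hsim; linarith)
  have hconj : ‖riemannZeta (σ + t * I)‖ = ‖riemannZeta (1 - s)‖ := by
    rw [show 1 - s = starRingEnd ℂ (σ + t * I) by
      rw [map_add, map_mul, conj_ofReal, conj_ofReal, conj_I, hs]; push_cast; ring,
      riemannZeta_conj, norm_conj]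
  have hpi : ‖(2 * (Real.pi : ℂ)) ^ (-s)‖ = (2 * Real.pi) ^ (-(1 - σ)) := by
    rw [show (2 * (Real.pi : ℂ)) = ((2 * Real.pi : ℝ) : ℂ) by push_cast; rfl,
      norm_cpow_eq_rpow_re_of_pos (by positivity)]
    simp [hs]
  rw [hconj, hfe, mul_assoc _ (Gamma s), norm_mul, norm_mul, norm_mul, hpi, norm_ofNat]
  have hpow : t ^ δ * t ^ (-(δ / 2)) = t ^ (δ / 2) := by
    rw [← Real.rpow_add (by linarith)]; ring_nf
  calc k * t ^ (δ / 2) = 2 * (2 * Real.pi) ^ (-(1 - σ)) * (c * t ^ δ) * t ^ (-(δ / 2)) := by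
        rw [← hpow]; ring
    _ ≤ _ := by
        gcongr
        exact hG t ht

lemma contDiff_riemannZeta_verticalLine {σ : ℝ} (hσ : σ ≠ 1) :
    ContDiff ℝ 1 fun t : ℝ => riemannZeta (σ + t * I) := by
  rw [contDiff_iff_contDiffAt]
  intro t
  have hne : (σ + t * I : ℂ) ≠ 1 := fun h => hσ (by simpa using congrArg re h)
  have hd : DifferentiableOn ℂ riemannZeta {1}ᶜ := fun s hs =>
    (differentiableAt_riemannZeta hs).differentiableWithinAt
  have hz : ContDiffAt ℂ 1 riemannZeta (σ + t * I) :=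
    (hd.contDiffOn isOpen_compl_singleton).contDiffAt (isOpen_compl_singleton.mem_nhds hne)
  exact (hz.restrict_scalars ℝ).comp t
    ((contDiff_const.add (ofRealCLM.contDiff.mul contDiff_const)).contDiffAt)

/-- Assuming the Riemann hypothesis, for every fixed real `σ < 1/2` the set
`{ζ(σ+it) : t ∈ ℝ}` is not dense in `ℂ`. -/
theorem zeta_not_dense_left_of_critical_line (hRH : RiemannHypothesis) (σ : ℝ)
    (hσ : σ < 1 / 2) :
    ¬ Dense (Set.range fun t : ℝ => riemannZeta (σ + t * I)) := by
  intro hdense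
  set f : ℝ → ℂ := fun t => riemannZeta (σ + t * I) with hf
  have hfC : ContDiff ℝ 1 f := contDiff_riemannZeta_verticalLine (by linarith)
  obtain ⟨T, hT⟩ := eventually_atTop.1
    ((tendsto_norm_riemannZeta_atTop hRH hσ).eventually_ge_atTop 1)
  have hbig : ∀ t : ℝ, T ≤ |t| → 1 ≤ ‖f t‖ := by
    intro t ht
    refine (hT _ ht).trans_eq ?_
    rcases abs_choice t with h | h
    · rw [h]
    · rw [h, hf, show (σ + ((-t : ℝ) : ℂ) * I : ℂ) = starRingEnd ℂ (σ + t * I) by simp,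
        riemannZeta_conj, norm_conj]
  have hK : IsClosed (f '' Set.Icc (-T) T) :=
    (isCompact_Icc.image hfC.continuous).isClosed
  obtain ⟨p, hp, hpf⟩ := (hfC.dense_compl_range_of_finrank_lt_finrank (by
    simp [finrank_real_complex])).exists_mem_open (Metric.isOpen_ball (x := (0 : ℂ)) (ε := 1))
    ⟨0, by simp⟩
  obtain ⟨_, hq, t, rfl⟩ := hdense.inter_open_nonempty _
    ((Metric.isOpen_ball (x := (0 : ℂ)) (ε := 1)).inter hK.isOpen_compl)
    ⟨p, hpf, fun h => hp (Set.image_subset_range _ _ h)⟩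
  have htT : T ≤ |t| := by
    by_contra! h
    exact hq.2 ⟨t, ⟨(abs_lt.1 h).1.le, (abs_lt.1 h).2.le⟩, rfl⟩
  exact absurd (mem_ball_zero_iff.1 hq.1) (not_lt.2 (hbig t htT))
end

section
/- Let a be a complex number. For every ε with 0 < ε < 1 there exists a positive integer N such that for every integer n ≥ N there is exactly one s ∈ ℂ with |s − (−2n)| < ε and ζ(s) = a, and this s satisfies ζ'(s) ≠ 0. -/
open Complex

theorem Complex.norm_le_norm_sin_pi_mul_div_two {z : ℂ} (hz : |z.re| ≤ 1) :
    ‖z‖ ≤ ‖sin (Real.pi * z / 2)‖ := by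
  have hre : |z.re| ≤ |Real.sin (Real.pi * z.re / 2)| := by
    have h := Real.mul_abs_le_abs_sin (x := Real.pi * z.re / 2) (by
      rw [abs_div, abs_mul, abs_of_pos Real.pi_pos, abs_of_pos (by norm_num : (0:ℝ) < 2)]
      nlinarith [Real.pi_pos])
    rw [abs_div, abs_mul, abs_of_pos Real.pi_pos, abs_of_pos (by norm_num : (0:ℝ) < 2)] at h
    convert h using 1
    field_simp
  have him : |z.im| ≤ |Real.sinh (Real.pi * z.im / 2)| := by
    rw [Real.abs_sinh]
    refine le_trans ?_ (Real.self_le_sinh_iff.2 (abs_nonneg _))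
    rw [abs_div, abs_mul, abs_of_pos Real.pi_pos, abs_of_pos (by norm_num : (0:ℝ) < 2)]
    nlinarith [Real.two_le_pi, abs_nonneg z.im]
  have hs : ‖sin (Real.pi * z / 2)‖ ^ 2 =
      Real.sin (Real.pi * z.re / 2) ^ 2 + Real.sinh (Real.pi * z.im / 2) ^ 2 := by
    have : (Real.pi * z / 2 : ℂ) =
        (Real.pi * z.re / 2 : ℝ) + (Real.pi * z.im / 2 : ℝ) * I := by
      apply Complex.ext <;> simp
    rw [this, sin_add_mul_I, ← ofReal_sin, ← ofReal_cos, ← ofReal_sinh, ← ofReal_cosh,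
      ← ofReal_mul, ← ofReal_mul, ← normSq_eq_norm_sq, normSq_add_mul_I]
    nlinarith [Real.sin_sq_add_cos_sq (Real.pi * z.re / 2), Real.cosh_sq (Real.pi * z.im / 2)]
  rw [← sq_le_sq₀ (norm_nonneg _) (norm_nonneg _), hs, ← normSq_eq_norm_sq, normSq_apply]
  nlinarith [sq_le_sq.2 hre, sq_le_sq.2 him]

theorem Complex.factorial_mul_norm_Gamma_le {u : ℂ} (hu : 1 ≤ u.re) (k : ℕ) :
    (k.factorial : ℝ) * ‖Gamma u‖ ≤ ‖Gamma (u + k)‖ := by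
  induction k with
  | zero => simp
  | succ k ih =>
    have hre : (k : ℝ) + 1 ≤ ‖u + k‖ := by
      refine le_trans ?_ (re_le_norm _)
      simp only [add_re, natCast_re]
      linarith
    have hne : u + k ≠ 0 := norm_pos_iff.1 (by linarith [k.cast_nonneg (α := ℝ)])
    rw [Nat.cast_succ, ← add_assoc, Gamma_add_one _ hne, norm_mul, Nat.factorial_succ]
    push_cast
    rw [mul_assoc]
    gcongr

theorem Complex.exists_pos_le_norm_Gamma_closedBall_two_one :
    ∃ c : ℝ, 0 < c ∧ ∀ u : ℂ, ‖u - 2‖ ≤ 1 → c ≤ ‖Gamma u‖ := by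
  have hre : ∀ u ∈ Metric.closedBall (2 : ℂ) 1, 0 < u.re := fun u hu ↦ by
    have := (abs_le.1 ((abs_re_le_norm (u - 2)).trans (mem_closedBall_iff_norm.1 hu))).1
    simp at this
    linarith
  obtain ⟨u, hu, hmin⟩ := (isCompact_closedBall (2 : ℂ) 1).exists_isMinOn ⟨2, by simp⟩
    (f := fun u ↦ ‖Gamma u‖) (fun u hu ↦ ((differentiableAt_Gamma u fun m h ↦ by
      have := hre u hu
      rw [h] at this
      simp at this
      linarith [m.cast_nonneg (α := ℝ)]).continuousAt.norm).continuousWithinAt)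
  exact ⟨_, norm_pos_iff.2 (Gamma_ne_zero_of_re_pos (hre u hu)),
    fun v hv ↦ hmin (mem_closedBall_iff_norm.2 hv)⟩

theorem exists_pos_le_norm_riemannZeta_of_two_le_re :
    ∃ c : ℝ, 0 < c ∧ ∀ s : ℂ, 2 ≤ s.re → c ≤ ‖riemannZeta s‖ := by
  set f : ℕ → ℂ := fun n ↦ (ArithmeticFunction.moebius n : ℂ)
  have hsum : ∀ s : ℂ, 2 ≤ s.re → LSeriesSummable f s := fun s hs ↦
    ArithmeticFunction.LSeriesSummable_moebius_iff.2 (by linarith)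
  have hC : 0 ≤ ∑' n, ‖LSeries.term f 2 n‖ := tsum_nonneg fun _ ↦ norm_nonneg _
  refine ⟨(∑' n, ‖LSeries.term f 2 n‖ + 1)⁻¹, by positivity, fun s hs ↦ ?_⟩
  have hle : ‖LSeries f s‖ ≤ ∑' n, ‖LSeries.term f 2 n‖ :=
    (norm_tsum_le_tsum_norm (hsum s hs).norm).trans <|
      (hsum s hs).norm.tsum_le_tsum (LSeries.norm_term_le_of_re_le_re f (by simpa using hs))
        (hsum 2 (by simp)).norm
  have hmul : riemannZeta s * LSeries f s = 1 := by
    rw [← LSeries_one_eq_riemannZeta (by linarith)]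
    exact LSeries_one_mul_Lseries_moebius (by linarith)
  have hnorm := congrArg norm hmul
  rw [norm_mul, norm_one] at hnorm
  rw [inv_le_iff_one_le_mul₀ (by positivity)]
  nlinarith [norm_nonneg (riemannZeta s)]

theorem mul_norm_le_norm_riemannZeta_near_trivial_zero {c d : ℝ} (hc0 : 0 ≤ c)
    (hc : ∀ u : ℂ, ‖u - 2‖ ≤ 1 → c ≤ ‖Gamma u‖) (hd0 : 0 ≤ d)
    (hd : ∀ s : ℂ, 2 ≤ s.re → d ≤ ‖riemannZeta s‖) (m : ℕ) {z : ℂ} (hz : ‖z‖ ≤ 1) :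
    2 * ((2 * Real.pi) ^ (2 * m + 4))⁻¹ * ((2 * m + 1).factorial * c) * ‖z‖ * d ≤
      ‖riemannZeta (-2 * ((m + 1 : ℕ) : ℂ) + z)‖ := by
  have hzre := abs_le.1 ((abs_re_le_norm z).trans hz)
  have hm : (0 : ℝ) ≤ m := m.cast_nonneg
  set w : ℂ := 2 - z + (2 * m + 1 : ℕ) with hw
  have hwre : w.re = 2 * m + 3 - z.re := by
    simp [hw]; ring
  have hs : -2 * ((m + 1 : ℕ) : ℂ) + z = 1 - w := by
    rw [hw]; push_cast; ring
  have hw_neg : ∀ k : ℕ, w ≠ -k := fun k h ↦ by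
    have := congrArg re h
    simp only [neg_re, natCast_re] at this
    linarith [k.cast_nonneg (α := ℝ), hzre.2]
  have hw_one : w ≠ 1 := fun h ↦ by
    have := congrArg re h
    simp only [one_re] at this
    linarith [hzre.2]
  have hcos : ‖z‖ ≤ ‖cos (Real.pi * w / 2)‖ := by
    have hcw : cos (Real.pi * w / 2) = (-1) ^ (m + 1) * sin (Real.pi * z / 2) := by
      have harg : (Real.pi * w / 2 : ℂ) =
          Real.pi / 2 - Real.pi * z / 2 + (m + 1 : ℕ) * Real.pi := by
        rw [hw]; push_cast; ring
      rw [harg, cos_antiperiodic.add_nat_mul_eq, cos_pi_div_two_sub]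
    rw [hcw, norm_mul, norm_pow, norm_neg, norm_one, one_pow, one_mul]
    exact norm_le_norm_sin_pi_mul_div_two ((abs_re_le_norm z).trans hz)
  have hpow : ((2 * Real.pi) ^ (2 * m + 4))⁻¹ ≤ ‖(2 * Real.pi : ℂ) ^ (-w)‖ := by
    have hcast : (2 * Real.pi : ℂ) = ((2 * Real.pi : ℝ) : ℂ) := by push_cast; rfl
    rw [hcast, norm_cpow_eq_rpow_re_of_pos Real.two_pi_pos, ← Real.rpow_natCast,
      ← Real.rpow_neg Real.two_pi_pos.le]
    refine Real.rpow_le_rpow_of_exponent_le (by linarith [Real.two_le_pi]) ?_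
    rw [neg_re, hwre]
    push_cast
    linarith [hzre.1]
  have hGamma : (2 * m + 1).factorial * c ≤ ‖Gamma w‖ :=
    le_trans (by gcongr; exact hc _ (by simpa using hz)) <|
      factorial_mul_norm_Gamma_le (by simpa using (by linarith [hzre.2] : 1 ≤ 2 - z.re)) _
  rw [hs, riemannZeta_one_sub hw_neg hw_one, norm_mul, norm_mul, norm_mul, norm_mul, norm_ofNat]
  gcongr
  exact hd w (by linarith [hzre.2])

theorem exists_forall_mul_norm_le_norm_riemannZeta (K : ℝ) :
    ∃ N : ℕ, 0 < N ∧ ∀ n : ℕ, N ≤ n → ∀ z : ℂ, ‖z‖ ≤ 1 →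
      K * ‖z‖ ≤ ‖riemannZeta (-2 * (n : ℂ) + z)‖ := by
  obtain ⟨c, hc0, hc⟩ := exists_pos_le_norm_Gamma_closedBall_two_one
  obtain ⟨d, hd0, hd⟩ := exists_pos_le_norm_riemannZeta_of_two_le_re
  have hlim := (FloorSemiring.tendsto_pow_div_factorial_atTop (2 * Real.pi)).mul_const
    (|K| * (2 * Real.pi) ^ 3)
  rw [zero_mul] at hlim
  obtain ⟨M, hM⟩ := Filter.eventually_atTop.1
    (hlim.eventually_le_const (by positivity : 0 < 2 * c * d))
  refine ⟨M + 1, M.succ_pos, fun n hn z hz ↦ ?_⟩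
  obtain ⟨m, rfl⟩ := Nat.exists_eq_add_one_of_ne_zero (by omega : n ≠ 0)
  refine le_trans ?_ (mul_norm_le_norm_riemannZeta_near_trivial_zero hc0.le hc hd0.le hd m hz)
  have hK := hM (2 * m + 1) (by omega)
  have hpi := Real.two_pi_pos
  calc K * ‖z‖ ≤ |K| * ‖z‖ := by gcongr; exact le_abs_self K
    _ = (2 * Real.pi) ^ (2 * m + 1) / (2 * m + 1).factorial * (|K| * (2 * Real.pi) ^ 3) *
        ((2 * m + 1).factorial * ((2 * Real.pi) ^ (2 * m + 4))⁻¹ * ‖z‖) := by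
      field_simp
      ring
    _ ≤ 2 * c * d * ((2 * m + 1).factorial * ((2 * Real.pi) ^ (2 * m + 4))⁻¹ * ‖z‖) := by
      gcongr
    _ = _ := by ring

theorem le_norm_dslope_of_forall_mul_norm_sub_le {f : ℂ → ℂ} {c : ℂ} {r K : ℝ} (hr : 0 < r)
    (hf : DifferentiableOn ℂ f (Metric.ball c r)) (hfc : f c = 0)
    (hK : ∀ s ∈ Metric.ball c r, K * ‖s - c‖ ≤ ‖f s‖) :
    ∀ s ∈ Metric.ball c r, K ≤ ‖dslope f c s‖ := by
  have hne : ∀ s ∈ Metric.ball c r, s ≠ c → K ≤ ‖dslope f c s‖ := fun s hs hsc ↦ by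
    have h := hK s hs
    rw [← sub_smul_dslope_of_zero hfc s, norm_smul, mul_comm] at h
    exact le_of_mul_le_mul_left h (norm_pos_iff.2 (sub_ne_zero.2 hsc))
  intro s hs
  rcases eq_or_ne s c with rfl | hsc
  · have hnhds : Metric.ball s r ∈ nhds s := Metric.ball_mem_nhds s hr
    have hcont : ContinuousAt (dslope f s) s :=
      continuousAt_dslope_same.2 (hf.differentiableAt hnhds)
    refine ge_of_tendsto (hcont.norm.tendsto.mono_left nhdsWithin_le_nhds : Filter.Tendsto _
      (nhdsWithin s {s}ᶜ) _) ?_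
    filter_upwards [nhdsWithin_le_nhds hnhds, self_mem_nhdsWithin] with t ht hts
    exact hne t ht hts
  · exact hne s hs hsc

/-- If `f` vanishes at `c` and `‖f s‖ ≥ K ‖s - c‖` near `c` with `K` large compared with `‖a‖`, then
`f s = a` has exactly one solution near `c`, as the fixed point of the contraction
`s ↦ c + a / dslope f c s`, and it is simple. -/
theorem existsUnique_eq_and_deriv_ne_zero_of_mul_norm_sub_le {f : ℂ → ℂ} {a c : ℂ} {ε r K : ℝ}
    (hε : 0 < ε) (hεr : ε < r) (hK0 : 0 < K) (hf : DifferentiableOn ℂ f (Metric.ball c r))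
    (hfc : f c = 0) (hK : ∀ s ∈ Metric.ball c r, K * ‖s - c‖ ≤ ‖f s‖)
    (haε : ‖a‖ ≤ ε / 2 * K) (har : ‖a‖ ≤ (r - ε) / 4 * K) :
    (∃! s, ‖s - c‖ < ε ∧ f s = a) ∧ ∀ s, ‖s - c‖ < ε → f s = a → deriv f s ≠ 0 := by
  have hr : 0 < r := hε.trans hεr
  set g := dslope f c
  have hgK := le_norm_dslope_of_forall_mul_norm_sub_le hr hf hfc hK
  have hg0 : ∀ s ∈ Metric.ball c r, g s ≠ 0 := fun s hs ↦
    norm_pos_iff.1 (hK0.trans_le (hgK s hs))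
  have hgd : DifferentiableOn ℂ g (Metric.ball c r) :=
    (differentiableOn_dslope (Metric.ball_mem_nhds c hr)).2 hf
  have hfg : ∀ s, (s - c) * g s = f s := fun s ↦ sub_smul_dslope_of_zero hfc s
  set h : ℂ → ℂ := fun s ↦ c + a / g s with hh
  have hhd : DifferentiableOn ℂ h (Metric.ball c r) :=
    (differentiableOn_const c).add ((differentiableOn_const a).div hgd hg0)
  have hhc : ∀ B : ℝ, 0 ≤ B → ‖a‖ ≤ B * K → ∀ s ∈ Metric.ball c r, ‖h s - c‖ ≤ B :=
    fun B hB hBK s hs ↦ by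
      rw [hh, add_sub_cancel_left, norm_div, div_le_iff₀ (norm_pos_iff.2 (hg0 s hs))]
      exact hBK.trans (by gcongr; exact hgK s hs)
  have hsub : Metric.ball c ε ⊆ Metric.ball c r := Metric.ball_subset_ball hεr.le
  have hderiv : ∀ s ∈ Metric.ball c ε, ‖deriv h s‖ ≤ 1 / 2 := fun s hs ↦ by
    have hR : 0 < (r - ε) / 2 := by linarith
    have hcl : Metric.closedBall s ((r - ε) / 2) ⊆ Metric.ball c r := fun t ht ↦ by
      have := dist_triangle t s c
      rw [Metric.mem_closedBall] at ht
      rw [Metric.mem_ball] at hs ⊢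
      linarith
    have hb := norm_deriv_le_of_forall_mem_sphere_norm_le (f := fun t ↦ h t - c) hR
      (((hhd.sub_const c).mono hcl).diffContOnCl_ball subset_rfl)
      fun t ht ↦ hhc ((r - ε) / 4) (by linarith) har t (hcl (Metric.sphere_subset_closedBall ht))
    rw [deriv_sub_const] at hb
    refine hb.trans (le_of_eq ?_)
    rw [div_eq_iff hR.ne']
    ring
  have hlip : ∀ s ∈ Metric.ball c ε, ∀ t ∈ Metric.ball c ε, ‖h t - h s‖ ≤ 1 / 2 * ‖t - s‖ :=
    fun s hs t ht ↦ (convex_ball c ε).norm_image_sub_le_of_norm_deriv_le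
      (fun x hx ↦ hhd.differentiableAt (Metric.isOpen_ball.mem_nhds (hsub hx))) hderiv hs ht
  have hfix : ∀ s ∈ Metric.ball c r, f s = a ↔ h s = s := fun s hs ↦ by
    rw [← hfg]
    simp only [hh]
    constructor
    · intro H
      rw [← H, mul_div_cancel_right₀ _ (hg0 s hs)]
      ring
    · intro H
      have hsc : s - c = a / g s := by linear_combination -H
      rw [hsc, div_mul_cancel₀ _ (hg0 s hs)]
  simp only [← mem_ball_iff_norm]
  refine ⟨?_, fun s hs hsa ↦ ?_⟩
  · have hss : Metric.closedBall c (ε / 2) ⊆ Metric.ball c ε :=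
      Metric.closedBall_subset_ball (by linarith)
    have hmaps : Set.MapsTo h (Metric.closedBall c (ε / 2)) (Metric.closedBall c (ε / 2)) :=
      fun s hs ↦ mem_closedBall_iff_norm.2 (hhc _ (by linarith) haε s (hsub (hss hs)))
    have hcontr : ContractingWith (1 / 2)
        (hmaps.restrict h (Metric.closedBall c (ε / 2)) (Metric.closedBall c (ε / 2))) := by
      refine ⟨by norm_num [← NNReal.coe_lt_coe], LipschitzWith.of_dist_le_mul fun s t ↦ ?_⟩
      simpa [Subtype.dist_eq, dist_eq_norm] using hlip t (hss t.2) s (hss s.2)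
    obtain ⟨s, hs, hsh, -⟩ := hcontr.exists_fixedPoint' Metric.isClosed_closedBall.isComplete
      hmaps (Metric.mem_closedBall_self (by linarith)) (edist_ne_top _ _)
    refine ⟨s, ⟨hss hs, (hfix s (hsub (hss hs))).2 hsh⟩, fun t ⟨ht, hta⟩ ↦ ?_⟩
    have hle := hlip s (hss hs) t ht
    rw [(hfix t (hsub ht)).1 hta, show h s = s from hsh] at hle
    exact sub_eq_zero.1 (norm_le_zero_iff.1 (by linarith))
  · intro hd0
    have hnhds : Metric.ball c r ∈ nhds s := Metric.isOpen_ball.mem_nhds (hsub hs)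
    have hgs := (hgd.differentiableAt hnhds).hasDerivAt
    have hg0s := hg0 s (hsub hs)
    have hhs : HasDerivAt h _ s := ((hasDerivAt_const s a).div hgs hg0s).const_add c
    have hfs : HasDerivAt f _ s :=
      (((hasDerivAt_id s).sub_const c).mul hgs).congr_of_eventuallyEq
        (Filter.Eventually.of_forall fun t ↦ (hfg t).symm)
    have hf' := hfs.deriv
    rw [hd0] at hf'
    have hone : deriv h s = 1 := by
      rw [hhs.deriv, div_eq_one_iff_eq (pow_ne_zero 2 hg0s), ← hsa, ← hfg s]
      simp only [id] at hf'
      linear_combination g s * hf'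
    have := hderiv s hs
    rw [hone, norm_one] at this
    norm_num at this

/-- For any complex number `a` and any `0 < ε < 1` there is a positive integer `N` such
that for every `n ≥ N` there is exactly one `s` with `|s − (−2n)| < ε` and `ζ(s) = a`,
and this `s` is a simple `a`-value, i.e. `ζ'(s) ≠ 0`. -/
theorem riemannZeta_simple_a_value_near_trivial_zeros (a : ℂ) (ε : ℝ)
    (hε0 : 0 < ε) (hε1 : ε < 1) :
    ∃ N : ℕ, 0 < N ∧ ∀ n : ℕ, N ≤ n →
      (∃! s : ℂ, ‖s - (-2 * (n : ℂ))‖ < ε ∧ riemannZeta s = a) ∧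
      ∀ s : ℂ, ‖s - (-2 * (n : ℂ))‖ < ε → riemannZeta s = a →
        deriv riemannZeta s ≠ 0 := by
  have hε1' : 0 < 1 - ε := by linarith
  set K : ℝ := ‖a‖ / (ε / 2) + ‖a‖ / ((1 - ε) / 4) + 1 with hK
  have hA : 0 ≤ ‖a‖ / (ε / 2) := by positivity
  have hB : 0 ≤ ‖a‖ / ((1 - ε) / 4) := by positivity
  obtain ⟨N, hN0, hN⟩ := exists_forall_mul_norm_le_norm_riemannZeta K
  refine ⟨N, hN0, fun n hn ↦ ?_⟩
  obtain ⟨m, rfl⟩ := Nat.exists_eq_add_one_of_ne_zero (by omega : n ≠ 0)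
  refine existsUnique_eq_and_deriv_ne_zero_of_mul_norm_sub_le (r := 1) (K := K) hε0 hε1
    (by positivity) (fun s hs ↦ ?_) ?_ (fun s hs ↦ ?_) ?_ ?_
  · refine (differentiableAt_riemannZeta fun hs1 ↦ ?_).differentiableWithinAt
    have := (abs_re_le_norm _).trans_lt (mem_ball_iff_norm.1 hs)
    rw [hs1] at this
    simp at this
    have := (abs_lt.1 this).2
    linarith [m.cast_nonneg (α := ℝ)]
  · exact_mod_cast riemannZeta_neg_two_mul_nat_add_one m
  · simpa using hN _ hn (s - (-2 * ((m + 1 : ℕ) : ℂ))) (mem_ball_iff_norm.1 hs).le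
  · rw [← div_le_iff₀' (by positivity)]
    linarith
  · rw [← div_le_iff₀' (by positivity)]
    linarith
end

section
/- Let a be a complex number and 0 < ε < 1. The set of s ∈ ℂ with Re s ≤ 0, ζ(s) = a, and |s − (−2n)| ≥ ε for every positive integer n, is finite. -/
open Complex Filter Topology

/-- The ratio `|Γ(σ + it)| / Γ(σ)` is at least its value at `σ = 1`, for `σ ≥ 1`. -/
lemma Gamma_mul_norm_Gamma_one_add_le {σ : ℝ} (hσ : 1 ≤ σ) (t : ℝ) :
    Real.Gamma σ * ‖Gamma (1 + t * I)‖ ≤ ‖Gamma (σ + t * I)‖ := by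
  have hlim (s : ℂ) : Tendsto (fun n ↦ ‖GammaSeq s n‖) atTop (𝓝 ‖Gamma s‖) :=
    (GammaSeq_tendsto_Gamma s).norm
  have hσΓ : ‖Gamma (σ : ℂ)‖ = Real.Gamma σ := by
    rw [Gamma_ofReal, norm_real, Real.norm_of_nonneg (Real.Gamma_nonneg_of_nonneg (by linarith))]
  have h1 := (hlim (σ : ℂ)).mul (hlim (1 + t * I))
  have h2 := (hlim (σ + t * I)).mul (hlim 1)
  rw [Gamma_one, norm_one, mul_one] at h2
  rw [hσΓ] at h1
  refine le_of_tendsto_of_tendsto h1 h2 ?_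
  filter_upwards [eventually_gt_atTop 0] with n hn
  have hn' : (0 : ℝ) < n := by exact_mod_cast hn
  have hnorm (s : ℂ) : ‖GammaSeq s n‖ =
      (n : ℝ) ^ s.re * (n.factorial : ℝ) / ∏ j ∈ Finset.range (n + 1), ‖s + j‖ := by
    rw [GammaSeq, norm_div, norm_mul, norm_prod, norm_natCast,
      ← ofReal_natCast, norm_cpow_eq_rpow_re_of_pos hn']
  have hpos (s : ℂ) (hs : 1 ≤ s.re) : 0 < ∏ j ∈ Finset.range (n + 1), ‖s + j‖ := by
    refine Finset.prod_pos fun j _ ↦ norm_pos_iff.mpr fun h ↦ ?_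
    have := congrArg re h
    simp at this
    have hj : (0 : ℝ) ≤ j := by positivity
    linarith
  have hprod : (∏ j ∈ Finset.range (n + 1), ‖(σ + t * I : ℂ) + j‖) *
      (∏ j ∈ Finset.range (n + 1), ‖(1 : ℂ) + j‖) ≤
      (∏ j ∈ Finset.range (n + 1), ‖(σ : ℂ) + j‖) *
      (∏ j ∈ Finset.range (n + 1), ‖(1 + t * I : ℂ) + j‖) := by
    rw [← Finset.prod_mul_distrib, ← Finset.prod_mul_distrib]
    refine Finset.prod_le_prod (fun _ _ ↦ by positivity) fun j _ ↦ ?_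
    have hj : (0 : ℝ) ≤ j := by positivity
    refine le_of_sq_le_sq ?_ (by positivity)
    rw [mul_pow, mul_pow]
    simp only [Complex.sq_norm, normSq_apply]
    simp
    have : (1 + (j : ℝ)) * (1 + j) ≤ (σ + j) * (σ + j) := by gcongr
    nlinarith [mul_le_mul_of_nonneg_right this (mul_self_nonneg t)]
  rw [hnorm, hnorm, hnorm, hnorm, div_mul_div_comm, div_mul_div_comm]
  simp only [add_re, ofReal_re, mul_re, I_re, mul_zero, ofReal_im, I_im, mul_one, sub_self,
    add_zero, one_re]
  have a1 := hpos (σ + t * I) (by simpa)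
  have a2 := hpos 1 (by simp)
  gcongr

lemma norm_Gamma_one_add_mul_I_sq (t : ℝ) (ht : t ≠ 0) :
    ‖Gamma (1 + t * I)‖ ^ 2 * Real.sinh (Real.pi * t) = Real.pi * t := by
  have h1 : Gamma (1 - t * I) = (starRingEnd ℂ) (Gamma (1 + t * I)) := by
    rw [← Gamma_conj]; simp [sub_eq_add_neg]
  have htI : (t * I : ℂ) ≠ 0 := by simp [ht]
  have h2 := Gamma_mul_Gamma_one_sub (t * I)
  have h3 : Gamma (1 + t * I) = t * I * Gamma (t * I) := by rw [add_comm, Gamma_add_one _ htI]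
  have h4 : sin (Real.pi * (t * I)) = Real.sinh (Real.pi * t) * I := by
    rw [← mul_assoc, sin_mul_I]; simp
  have hs : Real.sinh (Real.pi * t) ≠ 0 := by
    simp [Real.sinh_eq_zero, Real.pi_ne_zero, ht]
  have hs' : (Real.sinh (Real.pi * t) : ℂ) ≠ 0 := ofReal_ne_zero.mpr hs
  have h5 : ((‖Gamma (1 + t * I)‖ ^ 2 : ℝ) : ℂ) = Gamma (1 + t * I) * Gamma (1 - t * I) := by
    rw [h1, mul_conj, normSq_eq_norm_sq]
  have h6 : ((‖Gamma (1 + t * I)‖ ^ 2 * Real.sinh (Real.pi * t) : ℝ) : ℂ)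
      = ((Real.pi * t : ℝ) : ℂ) := by
    rw [ofReal_mul, h5, h3, mul_assoc (t * I : ℂ), h2, h4]
    field_simp
    push_cast; ring
  exact_mod_cast h6

lemma normSq_cos_pi_div_two (σ t : ℝ) :
    ‖cos (Real.pi * (σ + t * I) / 2)‖ ^ 2 =
      Real.cos (Real.pi * σ / 2) ^ 2 + Real.sinh (Real.pi * t / 2) ^ 2 := by
  have : (Real.pi * (σ + t * I) / 2 : ℂ) = ((Real.pi * σ / 2 : ℝ) : ℂ) +
      ((Real.pi * t / 2 : ℝ) : ℂ) * I := by push_cast; ring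
  rw [this, cos_add_mul_I, ← ofReal_cos, ← ofReal_sin, ← ofReal_cosh, ← ofReal_sinh,
    Complex.sq_norm, normSq_apply]
  generalize Real.pi * σ / 2 = x
  generalize Real.pi * t / 2 = y
  simp only [sub_re, sub_im, mul_re, mul_im, ofReal_re, ofReal_im, I_re, I_im]
  linear_combination Real.cos x ^ 2 * Real.cosh_sq y +
    Real.sinh y ^ 2 * Real.sin_sq_add_cos_sq x

lemma abs_le_norm_cos_pi_div_two (σ t : ℝ) :
    |t| ≤ ‖cos (Real.pi * (σ + t * I) / 2)‖ := by
  refine abs_le_of_sq_le_sq' ?_ (norm_nonneg _) |> abs_le.mpr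
  rw [normSq_cos_pi_div_two]
  have h : |t| ≤ |Real.sinh (Real.pi * t / 2)| := by
    rw [Real.abs_sinh]
    refine le_trans ?_ (Real.self_le_sinh_iff.mpr (abs_nonneg _))
    rw [abs_div, abs_mul, abs_of_pos Real.pi_pos, abs_two]
    nlinarith [Real.pi_gt_three, abs_nonneg t]
  nlinarith [sq_le_sq.mpr h, sq_nonneg (Real.cos (Real.pi * σ / 2))]

lemma exists_odd_abs_sub_le_norm_cos (σ t : ℝ) :
    ∃ k : ℤ, |σ - (2 * k + 1)| ≤ 1 ∧
      |σ - (2 * k + 1)| ≤ ‖cos (Real.pi * (σ + t * I) / 2)‖ := by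
  set k : ℤ := ⌊σ / 2⌋
  have h1 := Int.floor_le (σ / 2)
  have h2 := Int.lt_floor_add_one (σ / 2)
  have h3 : |σ - (2 * k + 1)| ≤ 1 := abs_le.mpr ⟨by linarith, by linarith⟩
  refine ⟨k, h3, ?_⟩
  have h4 : Real.cos (Real.pi * σ / 2) ^ 2 = Real.sin (Real.pi * |σ - (2 * k + 1)| / 2) ^ 2 := by
    have : Real.pi * σ / 2 = Real.pi * (σ - (2 * k + 1)) / 2 + Real.pi / 2 + k * Real.pi := by
      ring
    rw [this, Real.cos_add_int_mul_pi, Real.cos_add_pi_div_two, mul_pow]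
    have h5 : ((-1 : ℝ) ^ k) ^ 2 = 1 := by
      rw [← zpow_natCast, ← zpow_mul, mul_comm, zpow_mul]; norm_num
    rw [h5, one_mul, neg_sq]
    rcases abs_cases (σ - (2 * k + 1)) with h | h <;> rw [h.1]
    rw [mul_neg, neg_div, Real.sin_neg, neg_sq]
  have h6 : |σ - (2 * k + 1)| ≤ Real.sin (Real.pi * |σ - (2 * k + 1)| / 2) := by
    have := Real.mul_le_sin (x := Real.pi * |σ - (2 * k + 1)| / 2) (by positivity)
      (by nlinarith [Real.pi_pos])
    calc _ = 2 / Real.pi * (Real.pi * |σ - (2 * k + 1)| / 2) := by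
          field_simp
      _ ≤ _ := this
  refine le_of_sq_le_sq ?_ (norm_nonneg _)
  rw [normSq_cos_pi_div_two, h4]
  nlinarith [sq_nonneg (Real.sinh (Real.pi * t / 2)), abs_nonneg (σ - (2 * k + 1))]

lemma abs_le_norm_Gamma_mul_cos_sq (σ : ℝ) {t : ℝ} (ht : 1 ≤ |t|) :
    |t| / 2 ≤ (‖Gamma (1 + t * I)‖ * ‖cos (Real.pi * (σ + t * I) / 2)‖) ^ 2 := by
  have ht0 : t ≠ 0 := by rintro rfl; norm_num at ht
  set u := Real.pi * |t| / 2 with hu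
  have hu1 : 1 ≤ u := by nlinarith [Real.pi_gt_three]
  have hs : 0 < Real.sinh u := Real.sinh_pos_iff.mpr (by linarith)
  have hc : 0 < Real.cosh u := Real.cosh_pos u
  have hG : ‖Gamma (1 + t * I)‖ ^ 2 * (2 * Real.sinh u * Real.cosh u) = Real.pi * |t| := by
    rw [← Real.sinh_two_mul]
    have h2u : 2 * u = Real.pi * |t| := by rw [hu]; ring
    rw [h2u]
    have := norm_Gamma_one_add_mul_I_sq t ht0
    rcases abs_cases t with h | h <;> rw [h.1]
    · exact this
    · rw [mul_neg, Real.sinh_neg]; linarith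
  have hcos : Real.sinh u ^ 2 ≤ ‖cos (Real.pi * (σ + t * I) / 2)‖ ^ 2 := by
    rw [normSq_cos_pi_div_two]
    have : Real.sinh u ^ 2 = Real.sinh (Real.pi * t / 2) ^ 2 := by
      rw [← sq_abs (Real.sinh (Real.pi * t / 2)), Real.abs_sinh, abs_div, abs_mul,
        abs_of_pos Real.pi_pos, abs_two]
    nlinarith [sq_nonneg (Real.cos (Real.pi * σ / 2))]
  have htanh : Real.cosh u ≤ 2 * Real.sinh u := by
    have h1 : 1 ≤ Real.sinh u := hu1.trans (Real.self_le_sinh_iff.mpr (by linarith))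
    nlinarith [Real.cosh_sq u]
  have hG' : ‖Gamma (1 + t * I)‖ ^ 2 * Real.sinh u * Real.cosh u ≥ 3 / 2 * |t| := by
    nlinarith [Real.pi_gt_three]
  rw [mul_pow]
  calc |t| / 2 ≤ ‖Gamma (1 + t * I)‖ ^ 2 * Real.sinh u ^ 2 := by
        have : ‖Gamma (1 + t * I)‖ ^ 2 * Real.sinh u * Real.cosh u ≤
            ‖Gamma (1 + t * I)‖ ^ 2 * Real.sinh u * (2 * Real.sinh u) := by gcongr
        nlinarith
    _ ≤ _ := by gcongr

lemma tendsto_two_pi_rpow_neg_mul_Gamma :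
    Tendsto (fun σ : ℝ ↦ 2 * (2 * Real.pi) ^ (-σ) * Real.Gamma σ) atTop atTop := by
  set c : ℝ := 2 * Real.pi
  have hc : 1 < c := by simp only [c]; linarith [Real.pi_gt_three]
  have h0 : Tendsto (fun n : ℕ ↦ ((c ^ n / n.factorial)⁻¹)) atTop atTop := by
    refine Tendsto.inv_tendsto_nhdsGT_zero ?_
    refine tendsto_nhdsWithin_iff.mpr ⟨FloorSemiring.tendsto_pow_div_factorial_atTop c, ?_⟩
    exact Eventually.of_forall fun n ↦ by simp only [Set.mem_Ioi]; positivity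
  have h1 : Tendsto (fun σ : ℝ ↦ ⌊σ⌋₊ - 1) atTop atTop :=
    (tendsto_sub_atTop_nat 1).comp tendsto_nat_floor_atTop
  have h2 := ((h0.comp h1).const_mul_atTop (show 0 < 2 * (c ^ 2)⁻¹ by positivity))
  refine tendsto_atTop_mono' _ ?_ h2
  filter_upwards [eventually_ge_atTop 2] with σ hσ
  obtain ⟨m, hm⟩ : ∃ m, ⌊σ⌋₊ = m + 1 :=
    Nat.exists_eq_add_one.mpr (Nat.floor_pos.mpr (by linarith))
  have hm2 : 2 ≤ m + 1 := hm ▸ Nat.le_floor (by exact_mod_cast hσ)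
  have h3 : ((m : ℝ) + 1) ≤ σ := by
    have := Nat.floor_le (show 0 ≤ σ by linarith)
    rw [hm] at this; exact_mod_cast this
  have h4 : σ ≤ m + 2 := by
    have := (Nat.lt_floor_add_one σ).le
    rw [hm] at this; push_cast at this; linarith
  have h5 : (m.factorial : ℝ) ≤ Real.Gamma σ := by
    rw [← Real.Gamma_nat_eq_factorial]
    exact Real.Gamma_strictMonoOn_Ici.monotoneOn (by simp; exact_mod_cast hm2) hσ h3
  have h6 : (c ^ 2)⁻¹ * (c ^ m)⁻¹ ≤ c ^ (-σ) := by
    rw [← mul_inv, ← pow_add, Real.rpow_neg (by positivity), ← Real.rpow_natCast]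
    gcongr
    · exact hc.le
    · push_cast; linarith
  simp only [Function.comp, hm, Nat.add_sub_cancel, inv_div]
  calc _ = 2 * ((c ^ 2)⁻¹ * (c ^ m)⁻¹) * (m.factorial : ℝ) := by ring
    _ ≤ _ := by gcongr

/-- Comparison of a tail of a series with the integral of its summand: `F` is an antiderivative of
`f` vanishing at infinity. -/
lemma norm_tsum_nat_add_le {f F f' : ℝ → ℂ} {K : ℝ}
    (hF : ∀ x ≥ 1, HasDerivAt F (f x) x) (hf : ∀ x ≥ 1, HasDerivAt f (f' x) x)
    (hf' : ∀ x ≥ 1, ‖f' x‖ ≤ K * x ^ (-3 / 2 : ℝ)) (hlim : Tendsto F atTop (𝓝 0))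
    (hsum : Summable fun n : ℕ ↦ f (n + 1)) {N : ℕ} (hN : 1 ≤ N) :
    ‖(∑' n : ℕ, f ((n + N : ℕ) + 1)) + F N‖ ≤
      K * (N : ℝ) ^ (-1 / 4 : ℝ) * ∑' n : ℕ, ((n : ℝ) + 1) ^ (-5 / 4 : ℝ) := by
  have hK : 0 ≤ K := by simpa using (norm_nonneg _).trans (hf' 1 le_rfl)
  have hC : Summable fun n : ℕ ↦ ((n : ℝ) + 1) ^ (-5 / 4 : ℝ) := by
    have := (summable_nat_add_iff 1).mpr
      (Real.summable_nat_rpow (p := -5 / 4) |>.mpr (by norm_num))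
    simpa using this
  have hstep (y : ℝ) (hy : 1 ≤ y) :
      ‖f (y + 1) - (F (y + 1) - F y)‖ ≤ K * y ^ (-3 / 2 : ℝ) := by
    have hf1 : ∀ x ∈ Set.Icc y (y + 1), ‖f x - f (y + 1)‖ ≤ K * y ^ (-3 / 2 : ℝ) := by
      intro x hx
      have := (convex_Icc y (y + 1)).norm_image_sub_le_of_norm_hasDerivWithin_le
        (f := f) (f' := f') (C := K * y ^ (-3 / 2 : ℝ)) (x := y + 1) (y := x)
        (fun z hz ↦ (hf z (hy.trans hz.1)).hasDerivWithinAt)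
        (fun z hz ↦ (hf' z (hy.trans hz.1)).trans <| by
          refine mul_le_mul_of_nonneg_left ?_ hK
          exact Real.rpow_le_rpow_of_nonpos (by linarith) hz.1 (by norm_num))
        (Set.right_mem_Icc.mpr (by linarith)) hx
      refine this.trans (mul_le_of_le_one_right (by positivity) ?_)
      rw [Real.norm_eq_abs, abs_le]
      constructor <;> linarith [hx.1, hx.2]
    have := (convex_Icc y (y + 1)).norm_image_sub_le_of_norm_hasDerivWithin_le
        (f := fun x ↦ F x - x * f (y + 1)) (f' := fun x ↦ f x - 1 * f (y + 1))
        (C := K * y ^ (-3 / 2 : ℝ)) (x := y) (y := y + 1)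
        (fun z hz ↦ ((hF z (hy.trans hz.1)).sub
          ((ofRealCLM.hasDerivAt (x := z)).mul_const _)).hasDerivWithinAt)
        (fun z hz ↦ by simpa using hf1 z hz)
        (Set.left_mem_Icc.mpr (by linarith)) (Set.right_mem_Icc.mpr (by linarith))
    rw [norm_sub_rev]
    convert this using 1
    · congr 1; push_cast; ring
    · simp
  have hsum' : Summable fun n : ℕ ↦ f ((n + N : ℕ) + 1) := (summable_nat_add_iff N).mpr hsum
  have htel (m : ℕ) : ∑ n ∈ Finset.range m, (F ((n + N : ℕ) + 1) - F ((n + N : ℕ))) =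
      F ((m + N : ℕ)) - F N := by
    have := Finset.sum_range_sub (fun n ↦ F ((n + N : ℕ))) m
    simp only [zero_add] at this
    rw [← this]
    refine Finset.sum_congr rfl fun n _ ↦ ?_
    congr 2; push_cast; ring
  have hl : Tendsto (fun m : ℕ ↦ ∑ n ∈ Finset.range m,
      (f ((n + N : ℕ) + 1) - (F ((n + N : ℕ) + 1) - F ((n + N : ℕ))))) atTop
      (𝓝 ((∑' n : ℕ, f ((n + N : ℕ) + 1)) + F N)) := by
    simp only [Finset.sum_sub_distrib, htel]
    have h1 : Tendsto (fun m : ℕ ↦ F ((m + N : ℕ))) atTop (𝓝 0) :=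
      hlim.comp (tendsto_natCast_atTop_atTop.comp (tendsto_add_atTop_nat N))
    have := hsum'.hasSum.tendsto_sum_nat.sub (h1.sub_const (F N))
    simpa [← Finset.sum_sub_distrib, htel] using this
  refine le_of_tendsto hl.norm (Eventually.of_forall fun m ↦ (norm_sum_le _ _).trans ?_)
  have hN0 : (1 : ℝ) ≤ N := by exact_mod_cast hN
  calc _ ≤ ∑ n ∈ Finset.range m, K * (N : ℝ) ^ (-1 / 4 : ℝ) * ((n : ℝ) + 1) ^ (-5 / 4 : ℝ) := by
        refine Finset.sum_le_sum fun n _ ↦ (hstep _ ?_).trans ?_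
        · push_cast; have : (0 : ℝ) ≤ n := by positivity
          linarith
        · rw [mul_assoc]
          refine mul_le_mul_of_nonneg_left ?_ hK
          push_cast
          have hn : (0 : ℝ) ≤ n := by positivity
          have : ((n : ℝ) + N) ^ (-3 / 2 : ℝ) =
              ((n : ℝ) + N) ^ (-1 / 4 : ℝ) * ((n : ℝ) + N) ^ (-5 / 4 : ℝ) := by
            rw [← Real.rpow_add (by linarith)]; norm_num
          rw [this]
          exact mul_le_mul
            (Real.rpow_le_rpow_of_nonpos (by linarith) (by linarith) (by norm_num))
            (Real.rpow_le_rpow_of_nonpos (by linarith) (by linarith) (by norm_num))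
            (by positivity) (by positivity)
    _ ≤ _ := by
        rw [← Finset.mul_sum]
        exact mul_le_mul_of_nonneg_left (hC.sum_le_tsum _ fun _ _ ↦ by positivity) (by positivity)

lemma norm_ofReal_cpow_of_one_le {x : ℝ} (hx : 1 ≤ x) (w : ℂ) : ‖(x : ℂ) ^ w‖ = x ^ w.re :=
  norm_cpow_eq_rpow_re_of_pos (by linarith) _

lemma norm_ofReal_cpow_neg_sub_one_le {x : ℝ} (hx : 1 ≤ x) {w : ℂ} (hw : 1 < w.re) :
    ‖(x : ℂ) ^ (-w - 1)‖ ≤ x ^ (-2 : ℝ) := by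
  rw [norm_ofReal_cpow_of_one_le hx]
  exact Real.rpow_le_rpow_of_exponent_le hx (by simp; linarith)

lemma hasDerivAt_ofReal_cpow_of_one_le {x : ℝ} (hx : 1 ≤ x) (w : ℂ) :
    HasDerivAt (fun y : ℝ ↦ (y : ℂ) ^ w) (w * (x : ℂ) ^ (w - 1)) x := by
  have h : (x : ℂ) ∈ slitPlane := by simp; linarith
  simpa using ((hasDerivAt_id (x : ℂ)).cpow_const h (c := w)).comp_ofReal

lemma hasDerivAt_ofReal_log {x : ℝ} (hx : 1 ≤ x) :
    HasDerivAt (fun y : ℝ ↦ (Real.log y : ℂ)) ((x : ℂ)⁻¹) x := by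
  simpa using (Real.hasDerivAt_log (by linarith : x ≠ 0)).ofReal_comp

lemma tendsto_cpow_one_sub_atTop {w : ℂ} (hw : 1 < w.re) :
    Tendsto (fun x : ℝ ↦ (x : ℂ) ^ (1 - w)) atTop (𝓝 0) := by
  rw [tendsto_zero_iff_norm_tendsto_zero]
  refine (tendsto_rpow_neg_atTop (y := w.re - 1) (by linarith)).congr' ?_
  filter_upwards [eventually_ge_atTop 1] with x hx
  rw [norm_ofReal_cpow_of_one_le hx]; simp

lemma tendsto_log_mul_cpow_one_sub_atTop {w : ℂ} (hw : 1 < w.re) :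
    Tendsto (fun x : ℝ ↦ (Real.log x : ℂ) * (x : ℂ) ^ (1 - w)) atTop (𝓝 0) := by
  rw [tendsto_zero_iff_norm_tendsto_zero]
  have := (isLittleO_log_rpow_atTop (r := w.re - 1) (by linarith)).tendsto_div_nhds_zero
  refine this.congr' ?_
  filter_upwards [eventually_ge_atTop 1] with x hx
  rw [norm_mul, norm_ofReal_cpow_of_one_le hx, norm_real,
    Real.norm_of_nonneg (Real.log_nonneg hx), div_eq_mul_inv, ← Real.rpow_neg (by linarith)]
  simp

lemma cpow_neg_eq_self_mul {x : ℝ} (hx : 1 ≤ x) (w : ℂ) :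
    (x : ℂ) ^ (-w) = x * (x : ℂ) ^ (-w - 1) := by
  have : (x : ℂ) ≠ 0 := ofReal_ne_zero.mpr (by linarith)
  rw [cpow_sub _ _ this, cpow_one]; field_simp

/-- Tail of the Dirichlet series of `ζ`. -/
lemma norm_tsum_cpow_tail_le {w : ℂ} (hw : 1 < w.re) {N : ℕ} (hN : 1 ≤ N)
    (hsum : Summable fun n : ℕ ↦ (((n : ℝ) + 1 : ℝ) : ℂ) ^ (-w)) :
    ‖(∑' n : ℕ, (((n + N : ℕ) + 1 : ℝ) : ℂ) ^ (-w)) + ((N : ℝ) : ℂ) ^ (1 - w) / (1 - w)‖ ≤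
      (1 + 2 * ‖w‖) * (N : ℝ) ^ (-1 / 4 : ℝ) * ∑' n : ℕ, ((n : ℝ) + 1) ^ (-5 / 4 : ℝ) := by
  have hw1 : 1 - w ≠ 0 := fun h ↦ by have := congrArg re h; simp at this; linarith
  refine norm_tsum_nat_add_le (f := fun x ↦ (x : ℂ) ^ (-w))
    (F := fun x ↦ (x : ℂ) ^ (1 - w) / (1 - w))
    (f' := fun x ↦ -w * (x : ℂ) ^ (-w - 1)) (fun x hx ↦ ?_)
    (fun x hx ↦ hasDerivAt_ofReal_cpow_of_one_le hx _) (fun x hx ↦ ?_) ?_ hsum hN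
  · refine ((hasDerivAt_ofReal_cpow_of_one_le hx (1 - w)).div_const (1 - w)).congr_deriv ?_
    rw [mul_div_cancel_left₀ _ hw1]; congr 1; ring
  · rw [norm_mul, norm_neg]
    refine mul_le_mul (by linarith [norm_nonneg w])
      ((norm_ofReal_cpow_neg_sub_one_le hx hw).trans ?_) (norm_nonneg _) (by positivity)
    exact Real.rpow_le_rpow_of_exponent_le hx (by norm_num)
  · simpa using (tendsto_cpow_one_sub_atTop hw).div_const (1 - w)

/-- Tail of the Dirichlet series of the negated derivative of `ζ`. -/
lemma norm_tsum_log_mul_cpow_tail_le {w : ℂ} (hw : 1 < w.re) {N : ℕ} (hN : 1 ≤ N)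
    (hsum : Summable fun n : ℕ ↦
      (Real.log ((n : ℝ) + 1) : ℂ) * (((n : ℝ) + 1 : ℝ) : ℂ) ^ (-w)) :
    ‖(∑' n : ℕ, (Real.log ((n + N : ℕ) + 1) : ℂ) * (((n + N : ℕ) + 1 : ℝ) : ℂ) ^ (-w)) +
        ((Real.log N : ℂ) * ((N : ℝ) : ℂ) ^ (1 - w) / (1 - w) -
          ((N : ℝ) : ℂ) ^ (1 - w) / (1 - w) ^ 2)‖ ≤
      (1 + 2 * ‖w‖) * (N : ℝ) ^ (-1 / 4 : ℝ) * ∑' n : ℕ, ((n : ℝ) + 1) ^ (-5 / 4 : ℝ) := by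
  have hw1 : 1 - w ≠ 0 := fun h ↦ by have := congrArg re h; simp at this; linarith
  refine norm_tsum_nat_add_le (f := fun x ↦ (Real.log x : ℂ) * (x : ℂ) ^ (-w))
    (F := fun x ↦ (Real.log x : ℂ) * (x : ℂ) ^ (1 - w) / (1 - w) -
      (x : ℂ) ^ (1 - w) / (1 - w) ^ 2)
    (f' := fun x ↦ (x : ℂ)⁻¹ * (x : ℂ) ^ (-w) + Real.log x * (-w * (x : ℂ) ^ (-w - 1)))
    (fun x hx ↦ ?_)
    (fun x hx ↦ (hasDerivAt_ofReal_log hx).mul (hasDerivAt_ofReal_cpow_of_one_le hx _))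
    (fun x hx ↦ ?_) ?_ hsum hN
  · have hx0 : (x : ℂ) ≠ 0 := ofReal_ne_zero.mpr (by linarith)
    have h := hasDerivAt_ofReal_cpow_of_one_le hx (1 - w)
    refine ((((hasDerivAt_ofReal_log hx).mul h).div_const (1 - w)).sub
      (h.div_const ((1 - w) ^ 2))).congr_deriv ?_
    have e1 : (1 - w - 1 : ℂ) = -w := by ring
    have e2 : (x : ℂ) ^ (1 - w) = x * (x : ℂ) ^ (-w) := by
      rw [sub_eq_add_neg, cpow_add _ _ hx0, cpow_one]
    rw [e1, e2]
    field_simp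
    ring
  · have hx0 : (x : ℂ) ≠ 0 := ofReal_ne_zero.mpr (by linarith)
    rw [cpow_neg_eq_self_mul hx, inv_mul_cancel_left₀ hx0]
    have hl : Real.log x ≤ 2 * x ^ (1 / 2 : ℝ) := by
      have := Real.log_le_rpow_div (by linarith : 0 ≤ x) (show (0 : ℝ) < 1 / 2 by norm_num)
      linarith
    have hb := norm_ofReal_cpow_neg_sub_one_le hx hw
    have h32 : x ^ (-2 : ℝ) ≤ x ^ (-3 / 2 : ℝ) :=
      Real.rpow_le_rpow_of_exponent_le hx (by norm_num)
    have hmul : x ^ (1 / 2 : ℝ) * x ^ (-2 : ℝ) = x ^ (-3 / 2 : ℝ) := by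
      rw [← Real.rpow_add (by linarith)]; norm_num
    refine (norm_add_le _ _).trans ?_
    rw [norm_mul, norm_mul, norm_neg, norm_real, Real.norm_of_nonneg (Real.log_nonneg hx)]
    calc _ ≤ x ^ (-2 : ℝ) + 2 * x ^ (1 / 2 : ℝ) * (‖w‖ * x ^ (-2 : ℝ)) := by gcongr
      _ = x ^ (-2 : ℝ) + 2 * ‖w‖ * x ^ (-3 / 2 : ℝ) := by rw [← hmul]; ring
      _ ≤ _ := by linarith
  · simpa using ((tendsto_log_mul_cpow_one_sub_atTop hw).div_const (1 - w)).sub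
      ((tendsto_cpow_one_sub_atTop hw).div_const ((1 - w) ^ 2))

open LSeries in
lemma hasSum_riemannZeta_of_one_lt_re {w : ℂ} (hw : 1 < w.re) :
    HasSum (fun n : ℕ ↦ (((n : ℝ) + 1 : ℝ) : ℂ) ^ (-w)) (riemannZeta w) := by
  have h := LSeriesHasSum_one hw
  rw [LSeriesHasSum, ← hasSum_nat_add_iff' 1] at h
  simp only [Finset.range_one, Finset.sum_singleton, term_zero, sub_zero] at h
  refine h.congr_fun fun n ↦ ?_
  rw [term_of_ne_zero (by simp), cpow_neg]
  simp

open LSeries in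
lemma hasSum_deriv_riemannZeta_of_one_lt_re {w : ℂ} (hw : 1 < w.re) :
    HasSum (fun n : ℕ ↦ (Real.log ((n : ℝ) + 1) : ℂ) * (((n : ℝ) + 1 : ℝ) : ℂ) ^ (-w))
      (-deriv riemannZeta w) := by
  have habs : abscissaOfAbsConv 1 < w.re := by
    rw [abscissaOfAbsConv_one]; exact_mod_cast hw
  have hd : deriv riemannZeta w = -LSeries (logMul 1) w := by
    rw [← LSeries_deriv habs]
    refine EventuallyEq.deriv_eq ?_
    filter_upwards [(isOpen_lt continuous_const continuous_re).mem_nhds hw] with z hz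
    exact (LSeries_one_eq_riemannZeta hz).symm
  have h := (LSeriesSummable_logMul_of_lt_re habs).LSeriesHasSum
  rw [LSeriesHasSum, ← hasSum_nat_add_iff' 1] at h
  simp only [Finset.range_one, Finset.sum_singleton, term_zero, sub_zero] at h
  rw [hd, neg_neg]
  refine h.congr_fun fun n ↦ ?_
  rw [term_of_ne_zero (by simp), cpow_neg, logMul]
  have : ((n : ℝ) + 1) = ((n + 1 : ℕ) : ℝ) := by push_cast; rfl
  rw [this, ofReal_log (by positivity), ofReal_natCast]
  simp [div_eq_mul_inv]

/-- Splitting a series into a head bounded by a harmonic sum and a controlled tail. -/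
lemma norm_tsum_le_of_harmonic {g : ℕ → ℂ} {S E : ℂ} {A T : ℝ} (hg : HasSum g S) {N : ℕ}
    (hA : 0 ≤ A) (hhead : ∀ n < N, ‖g n‖ ≤ A * ((n : ℝ) + 1)⁻¹)
    (htail : ‖(∑' n, g (n + N)) + E‖ ≤ T) :
    ‖S‖ ≤ A * (1 + Real.log N) + ‖E‖ + T := by
  have h1 : S = (∑ n ∈ Finset.range N, g n) + (((∑' n, g (n + N)) + E) - E) := by
    rw [← hg.tsum_eq, ← hg.summable.sum_add_tsum_nat_add N]; ring
  have h2 : ‖∑ n ∈ Finset.range N, g n‖ ≤ A * (1 + Real.log N) := by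
    refine (norm_sum_le_of_le _ fun n hn ↦ hhead n (Finset.mem_range.mp hn)).trans ?_
    rw [← Finset.mul_sum]
    refine mul_le_mul_of_nonneg_left ?_ hA
    have := harmonic_le_one_add_log N
    simpa [harmonic] using this
  rw [h1]
  refine (norm_add_le _ _).trans ?_
  have := norm_sub_le ((∑' n, g (n + N)) + E) E
  linarith

lemma norm_natCast_cpow_one_sub_le {w : ℂ} (hw : 1 < w.re) {N : ℕ} (hN : 1 ≤ N) :
    ‖((N : ℝ) : ℂ) ^ (1 - w)‖ ≤ 1 := by
  have hN' : (1 : ℝ) ≤ N := by exact_mod_cast hN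
  rw [norm_ofReal_cpow_of_one_le hN']
  exact Real.rpow_le_one_of_one_le_of_nonpos hN' (by simp; linarith)

lemma norm_cpow_neg_le_inv {w : ℂ} (hw : 1 < w.re) (n : ℕ) :
    ‖(((n : ℝ) + 1 : ℝ) : ℂ) ^ (-w)‖ ≤ ((n : ℝ) + 1)⁻¹ := by
  have hn : (1 : ℝ) ≤ (n : ℝ) + 1 := by linarith [n.cast_nonneg (α := ℝ)]
  rw [norm_ofReal_cpow_of_one_le hn, ← Real.rpow_neg_one]
  exact Real.rpow_le_rpow_of_exponent_le hn (by simp; linarith)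

lemma norm_riemannZeta_le_of_one_lt_re {w : ℂ} (hw : 1 < w.re) {N : ℕ} (hN : 1 ≤ N) :
    ‖riemannZeta w‖ ≤ (1 + Real.log N) + ‖1 - w‖⁻¹ +
      (1 + 2 * ‖w‖) * (N : ℝ) ^ (-1 / 4 : ℝ) * ∑' n : ℕ, ((n : ℝ) + 1) ^ (-5 / 4 : ℝ) := by
  have hs := hasSum_riemannZeta_of_one_lt_re hw
  have := norm_tsum_le_of_harmonic hs (A := 1) zero_le_one
    (fun n _ ↦ by simpa using norm_cpow_neg_le_inv hw n)
    (norm_tsum_cpow_tail_le hw hN hs.summable)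
  rw [one_mul, norm_div] at this
  refine this.trans ?_
  gcongr
  rw [div_eq_mul_inv]
  exact mul_le_of_le_one_left (by positivity) (norm_natCast_cpow_one_sub_le hw hN)

lemma norm_deriv_riemannZeta_le_of_one_lt_re {w : ℂ} (hw : 1 < w.re) {N : ℕ} (hN : 1 ≤ N) :
    ‖deriv riemannZeta w‖ ≤ Real.log N * (1 + Real.log N) +
      (Real.log N * ‖1 - w‖⁻¹ + ‖1 - w‖⁻¹ ^ 2) +
      (1 + 2 * ‖w‖) * (N : ℝ) ^ (-1 / 4 : ℝ) * ∑' n : ℕ, ((n : ℝ) + 1) ^ (-5 / 4 : ℝ) := by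
  have hs := hasSum_deriv_riemannZeta_of_one_lt_re hw
  have hlog : 0 ≤ Real.log N := Real.log_natCast_nonneg N
  have := norm_tsum_le_of_harmonic hs (A := Real.log N) hlog
    (fun n hn ↦ by
      have hn1 : ((n : ℝ) + 1) ≤ N := by exact_mod_cast hn
      have h0 : 0 ≤ Real.log ((n : ℝ) + 1) := by
        exact_mod_cast Real.log_natCast_nonneg (n + 1)
      rw [norm_mul, norm_real, Real.norm_of_nonneg h0]
      exact mul_le_mul (Real.log_le_log (by positivity) hn1) (norm_cpow_neg_le_inv hw n)
        (norm_nonneg _) hlog)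
    (norm_tsum_log_mul_cpow_tail_le hw hN hs.summable)
  rw [norm_neg] at this
  refine this.trans ?_
  have hp := norm_natCast_cpow_one_sub_le hw hN
  gcongr
  refine (norm_sub_le _ _).trans ?_
  rw [norm_div, norm_div, norm_mul, norm_pow, norm_real, Real.norm_of_nonneg hlog, inv_pow,
    div_eq_mul_inv, div_eq_mul_inv]
  gcongr
  · exact mul_le_of_le_one_right hlog hp
  · exact mul_le_of_le_one_left (by positivity) hp

/-- Polynomial bounds for `ζ` and `ζ'` just to the right of the line `Re w = 1`. -/
lemma exists_norm_riemannZeta_and_deriv_le : ∃ C : ℝ, 1 ≤ C ∧ ∀ w : ℂ, 1 < w.re → w.re ≤ 2 →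
    1 ≤ |w.im| → ‖riemannZeta w‖ ≤ C * |w.im| ^ (1 / 16 : ℝ) ∧
      ‖deriv riemannZeta w‖ ≤ C * |w.im| ^ (1 / 16 : ℝ) := by
  set D : ℝ := ∑' n : ℕ, ((n : ℝ) + 1) ^ (-5 / 4 : ℝ)
  have hD : 0 ≤ D := tsum_nonneg fun _ ↦ by positivity
  refine ⟨131 ^ 2 + 7 * D, by linarith, fun w hw hw2 ht ↦ ?_⟩
  set t := |w.im|
  have ht0 : 0 < t := by linarith
  set N := ⌈t ^ 4⌉₊
  have hNt : t ^ 4 ≤ N := Nat.le_ceil _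
  have ht4 : 1 ≤ t ^ 4 := one_le_pow₀ ht
  have hN2 : (N : ℝ) ≤ 2 * t ^ 4 := by
    have := (Nat.ceil_lt_add_one (show 0 ≤ t ^ 4 by positivity)).le
    linarith
  have hN1 : (1 : ℝ) ≤ N := ht4.trans hNt
  have hN : 1 ≤ N := by exact_mod_cast hN1
  have hlog0 : 0 ≤ Real.log N := Real.log_natCast_nonneg N
  have hpow1 : 1 ≤ t ^ (1 / 32 : ℝ) := Real.one_le_rpow ht (by norm_num)
  have hsq : (t ^ (1 / 32 : ℝ)) ^ 2 = t ^ (1 / 16 : ℝ) := by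
    rw [← Real.rpow_natCast, ← Real.rpow_mul ht0.le]; norm_num
  have hlog : 2 + Real.log N ≤ 131 * t ^ (1 / 32 : ℝ) := by
    have h1 : Real.log N ≤ Real.log 2 + 4 * Real.log t := by
      refine (Real.log_le_log (by linarith) hN2).trans_eq ?_
      rw [Real.log_mul (by norm_num) (by positivity), Real.log_pow]; norm_num
    have h2 := Real.log_le_rpow_div ht0.le (show (0 : ℝ) < 1 / 32 by norm_num)
    have h3 := Real.log_two_lt_d9
    linarith
  have hmain : (2 + Real.log N) ^ 2 ≤ 131 ^ 2 * t ^ (1 / 16 : ℝ) := by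
    rw [← hsq, ← mul_pow]
    gcongr
  have hinv : ‖1 - w‖⁻¹ ≤ 1 := by
    refine inv_le_one_of_one_le₀ (ht.trans ?_)
    simpa using abs_im_le_norm (1 - w)
  have hinv0 : 0 ≤ ‖1 - w‖⁻¹ := by positivity
  have htail : (1 + 2 * ‖w‖) * (N : ℝ) ^ (-1 / 4 : ℝ) * D ≤ 7 * D * t ^ (1 / 16 : ℝ) := by
    have h1 : (N : ℝ) ^ (-1 / 4 : ℝ) ≤ t⁻¹ := by
      have : (t ^ 4 : ℝ) ^ (-1 / 4 : ℝ) = t⁻¹ := by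
        rw [← Real.rpow_natCast, ← Real.rpow_mul ht0.le, ← Real.rpow_neg_one]; norm_num
      rw [← this]
      exact Real.rpow_le_rpow_of_nonpos (by positivity) hNt (by norm_num)
    have h2 : 1 + 2 * ‖w‖ ≤ 7 * t := by
      have := norm_le_abs_re_add_abs_im w
      rw [abs_of_pos (by linarith : 0 < w.re)] at this
      change _ ≤ _ + t at this
      linarith
    have h3 : (1 + 2 * ‖w‖) * (N : ℝ) ^ (-1 / 4 : ℝ) ≤ 7 := by
      calc _ ≤ 7 * t * t⁻¹ := by gcongr
        _ = 7 := by field_simp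
    calc _ ≤ 7 * D := by gcongr
      _ ≤ _ := le_mul_of_one_le_right (by positivity) (Real.one_le_rpow ht (by norm_num))
  constructor
  · have := norm_riemannZeta_le_of_one_lt_re hw hN
    change _ ≤ _ + _ * D at this
    nlinarith
  · have := norm_deriv_riemannZeta_le_of_one_lt_re hw hN
    change _ ≤ _ + _ * D at this
    have h2 : Real.log N * ‖1 - w‖⁻¹ ≤ Real.log N := mul_le_of_le_one_right hlog0 hinv
    nlinarith

lemma exists_norm_riemannZeta_one_add_le : ∃ A : ℝ, 1 ≤ A ∧ ∀ x : ℝ, 0 < x → x ≤ 1 →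
    ‖riemannZeta (1 + x)‖ ≤ A / x := by
  set D : ℝ := ∑' n : ℕ, ((n : ℝ) + 1) ^ (-5 / 4 : ℝ)
  have hD : 0 ≤ D := tsum_nonneg fun _ ↦ by positivity
  refine ⟨2 + 5 * D, by linarith, fun x hx hx1 ↦ ?_⟩
  have := norm_riemannZeta_le_of_one_lt_re (w := 1 + x) (by simpa) le_rfl
  have hn : ‖(1 : ℂ) + x‖ = 1 + x := by
    rw [← ofReal_one, ← ofReal_add, norm_real, Real.norm_of_nonneg (by linarith)]
  have hn' : ‖(1 : ℂ) - (1 + x)‖ = x := by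
    rw [sub_add_cancel_left, norm_neg, norm_real, Real.norm_of_nonneg hx.le]
  rw [hn, hn'] at this
  simp only [Nat.cast_one, Real.log_one, Real.one_rpow] at this
  change _ ≤ _ + _ * D at this
  have hxi : 1 ≤ x⁻¹ := one_le_inv_iff₀.mpr ⟨hx, hx1⟩
  rw [div_eq_mul_inv]
  nlinarith [mul_le_mul_of_nonneg_left hxi hD, mul_le_mul_of_nonneg_right hx1 hD]

/-- The `3-4-1` inequality for `ζ`. -/
lemma one_le_norm_riemannZeta_product {x : ℝ} (hx : 0 < x) (t : ℝ) :
    1 ≤ ‖riemannZeta (1 + x)‖ ^ 3 * ‖riemannZeta ((1 + x : ℝ) + t * I)‖ ^ 4 *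
      ‖riemannZeta ((1 + x : ℝ) + (2 * t : ℝ) * I)‖ := by
  have h := DirichletCharacter.norm_LFunction_product_ge_one (1 : DirichletCharacter ℂ 1) hx t
  rw [DirichletCharacter.LFunctionTrivChar, DirichletCharacter.LFunction_modOne_eq,
    DirichletCharacter.LFunction_modOne_eq, norm_mul, norm_mul, norm_pow, norm_pow] at h
  have e1 : ((1 + x : ℝ) : ℂ) + t * I = 1 + x + I * t := by push_cast; ring
  have e2 : ((1 + x : ℝ) : ℂ) + (2 * t : ℝ) * I = 1 + x + 2 * I * t := by push_cast; ring
  rw [e1, e2]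
  exact h

lemma exists_le_norm_riemannZeta_of_one_lt_re_le_two : ∃ c : ℝ, 0 < c ∧ ∀ σ t : ℝ, 1 < σ → σ ≤ 2 →
    1 ≤ |t| → c * |t| ^ (-1 / 4 : ℝ) ≤ ‖riemannZeta (σ + t * I)‖ := by
  obtain ⟨C, hC, hζ⟩ := exists_norm_riemannZeta_and_deriv_le
  obtain ⟨A, hA, hpole⟩ := exists_norm_riemannZeta_one_add_le
  refine ⟨1 / (32 * A ^ 3 * C ^ 4), by positivity, fun σ t hσ hσ2 ht ↦ ?_⟩
  have ht0 : 0 < |t| := by linarith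
  set B := C * |2 * t| ^ (1 / 16 : ℝ) with hB
  have h2t : |2 * t| = 2 * |t| := by rw [abs_mul, abs_two]
  have hB1 : 1 ≤ B := one_le_mul_of_one_le_of_one_le hC
    (Real.one_le_rpow (by rw [h2t]; linarith) (by norm_num))
  have hB4 : B ^ 4 ≤ 2 * C ^ 4 * |t| ^ (1 / 4 : ℝ) := by
    have h1 : (|2 * t| ^ (1 / 16 : ℝ)) ^ 4 = 2 ^ (1 / 4 : ℝ) * |t| ^ (1 / 4 : ℝ) := by
      rw [← Real.rpow_natCast, ← Real.rpow_mul (abs_nonneg _), h2t,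
        ← Real.mul_rpow (by norm_num) ht0.le]
      norm_num
    have h2 : (2 : ℝ) ^ (1 / 4 : ℝ) ≤ 2 := by
      simpa using Real.rpow_le_rpow_of_exponent_le (one_le_two (α := ℝ))
        (show (1 / 4 : ℝ) ≤ 1 by norm_num)
    rw [hB, mul_pow, h1]
    calc _ ≤ C ^ 4 * (2 * |t| ^ (1 / 4 : ℝ)) := by gcongr
      _ = _ := by ring
  set d := 1 / (16 * A ^ 3 * B ^ 5) with hd
  have hd0 : 0 < d := by positivity
  have hd1 : d ≤ 1 := by
    rw [hd, div_le_one (by positivity)]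
    nlinarith [one_le_pow₀ hA (n := 3), one_le_pow₀ hB1 (n := 5)]
  have hlarge (y : ℝ) (hy : d ≤ y) (hy1 : y ≤ 1) :
      2 * B * d ≤ ‖riemannZeta ((1 + y : ℝ) + t * I)‖ := by
    have hy0 : 0 < y := hd0.trans_le hy
    set X := ‖riemannZeta ((1 + y : ℝ) + t * I)‖
    have h1 := one_le_norm_riemannZeta_product hy0 t
    have h2 : ‖riemannZeta ((1 + y : ℝ) + (2 * t : ℝ) * I)‖ ≤ B := by
      have := (hζ ((1 + y : ℝ) + (2 * t : ℝ) * I) (by simpa) (by simp; linarith)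
        (by simp; linarith)).1
      rwa [show ((1 + y : ℝ) + (2 * t : ℝ) * I : ℂ).im = 2 * t by simp] at this
    have h3 : 1 ≤ (A / y) ^ 3 * X ^ 4 * B := by
      refine h1.trans ?_
      gcongr
      exact hpole y hy0 hy1
    have h4 : 1 ≤ (A / d) ^ 3 * X ^ 4 * B := by
      refine h3.trans ?_
      gcongr
    refine le_of_pow_le_pow_left₀ (n := 4) (by norm_num) (norm_nonneg _) ?_
    have h5 : (2 * B * d) ^ 4 * ((A / d) ^ 3 * B) = 1 := by
      rw [hd]; field_simp; norm_num
    have h6 : 0 < (A / d) ^ 3 * B := by positivity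
    refine le_of_mul_le_mul_right ?_ h6
    rw [h5]
    linarith
  have hfin : 1 / (32 * A ^ 3 * C ^ 4) * |t| ^ (-1 / 4 : ℝ) ≤ B * d := by
    have h1 : B * d = 1 / (16 * A ^ 3 * B ^ 4) := by rw [hd]; field_simp
    have h2 : 1 / (32 * A ^ 3 * C ^ 4) * |t| ^ (-1 / 4 : ℝ) =
        1 / (16 * A ^ 3 * (2 * C ^ 4 * |t| ^ (1 / 4 : ℝ))) := by
      rw [neg_div, Real.rpow_neg ht0.le]; field_simp; norm_num
    rw [h1, h2]
    gcongr
  refine hfin.trans ?_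
  rcases le_total (1 + d) σ with h | h
  · have := hlarge (σ - 1) (by linarith) (by linarith)
    rw [add_sub_cancel] at this
    nlinarith [mul_pos (zero_lt_one.trans_le hB1) hd0]
  · have h1 := hlarge d le_rfl hd1
    have hconv : Convex ℝ
        ({w : ℂ | 1 < w.re} ∩ {w | w.re ≤ 2} ∩ ({w | w.im ≤ t} ∩ {w | t ≤ w.im})) :=
      ((convex_halfSpace_re_gt 1).inter (convex_halfSpace_re_le 2)).inter
        ((convex_halfSpace_im_le t).inter (convex_halfSpace_im_ge t))
    have h2 := hconv.norm_image_sub_le_of_norm_deriv_le (f := riemannZeta) (C := B)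
      (x := σ + t * I) (y := (1 + d : ℝ) + t * I)
      (fun w hw ↦ differentiableAt_riemannZeta fun h ↦ by simp [h] at hw)
      (fun w hw ↦ by
        obtain ⟨⟨ha, hb⟩, hc, hd⟩ := hw
        have him : w.im = t := le_antisymm hc hd
        refine (hζ w ha hb (by rwa [him])).2.trans ?_
        rw [him, hB, h2t]
        gcongr
        linarith)
      (by simp; exact ⟨hσ, hσ2⟩) (by simp; constructor <;> linarith)
    have h3 : ‖((1 + d : ℝ) + t * I : ℂ) - (σ + t * I)‖ ≤ d := by
      rw [add_sub_add_right_eq_sub, ← ofReal_sub, norm_real, Real.norm_eq_abs, abs_le]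
      constructor <;> linarith
    have h4 := norm_sub_norm_le (riemannZeta ((1 + d : ℝ) + t * I)) (riemannZeta (σ + t * I))
    have h5 := mul_le_mul_of_nonneg_left h3 (zero_le_one.trans hB1)
    linarith

lemma quarter_le_norm_riemannZeta_of_two_le_re {w : ℂ} (hw : 2 ≤ w.re) :
    1 / 4 ≤ ‖riemannZeta w‖ := by
  have h := hasSum_riemannZeta_of_one_lt_re (w := w) (by linarith)
  rw [← hasSum_nat_add_iff' 1] at h
  have h2 := hasSum_zeta_two
  rw [← hasSum_nat_add_iff' 2] at h2
  simp only [Finset.sum_range_succ, Finset.range_zero, Finset.sum_empty] at h h2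
  norm_num at h h2
  have h3 : ‖riemannZeta w - 1‖ ≤ Real.pi ^ 2 / 6 - 1 := by
    rw [← h.tsum_eq]
    refine tsum_of_norm_bounded h2 fun n ↦ ?_
    have hn : (1 : ℝ) ≤ (n : ℝ) + 1 + 1 := by linarith [n.cast_nonneg (α := ℝ)]
    have := norm_ofReal_cpow_of_one_le hn (-w)
    push_cast at this
    rw [this]
    have e : ((n + 2 : ℝ) ^ 2)⁻¹ = ((n : ℝ) + 1 + 1) ^ (-2 : ℝ) := by
      rw [Real.rpow_neg (by positivity)]; norm_num; ring
    rw [e]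
    exact Real.rpow_le_rpow_of_exponent_le hn (by simp; linarith)
  have h4 := norm_sub_norm_le (1 : ℂ) (1 - riemannZeta w)
  rw [sub_sub_cancel, norm_one, norm_sub_rev] at h4
  nlinarith [Real.pi_lt_d2, Real.pi_pos]

/-- A lower bound for `ζ` in the closed half-plane `Re w ≥ 1`. -/
lemma exists_le_norm_riemannZeta_of_one_le_re : ∃ c : ℝ, 0 < c ∧ ∀ σ t : ℝ, 1 ≤ σ →
    1 ≤ |t| → c * |t| ^ (-1 / 4 : ℝ) ≤ ‖riemannZeta (σ + t * I)‖ := by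
  obtain ⟨c, hc, h⟩ := exists_le_norm_riemannZeta_of_one_lt_re_le_two
  refine ⟨min c (1 / 4), by positivity, fun σ t hσ ht ↦ ?_⟩
  have ht0 : 0 < |t| := by linarith
  rcases le_total 2 σ with h2 | h2
  · refine le_trans ?_ (quarter_le_norm_riemannZeta_of_two_le_re (by simpa))
    calc _ ≤ 1 / 4 * (1 : ℝ) := by
          gcongr
          · exact min_le_right _ _
          · exact Real.rpow_le_one_of_one_le_of_nonpos ht (by norm_num)
      _ = _ := mul_one _
  · refine (mul_le_mul_of_nonneg_right (min_le_left _ _) (by positivity)).trans ?_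
    rcases hσ.eq_or_lt with rfl | hσ1
    · have hne : ((1 : ℝ) + t * I : ℂ) ≠ 1 := fun h ↦ by
        have := congrArg im h
        simp at this
        simp [this] at ht0
      have hcont : ContinuousAt (fun σ : ℝ ↦ ‖riemannZeta (σ + t * I)‖) 1 := by
        refine ContinuousAt.norm ?_
        exact ContinuousAt.comp (f := fun σ : ℝ ↦ (σ + t * I : ℂ))
          (differentiableAt_riemannZeta hne).continuousAt (by fun_prop)
      refine ge_of_tendsto (hcont.tendsto.mono_left (nhdsWithin_le_nhds (s := Set.Ioi 1))) ?_
      filter_upwards [Ioo_mem_nhdsGT (show (1 : ℝ) < 2 by norm_num)] with x hx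
      exact h x t hx.1 hx.2.le ht
    · exact h σ t hσ1 h2 ht

/-- The functional equation, with the Gamma factor bounded below. -/
lemma le_norm_riemannZeta_one_sub {σ t : ℝ} (hσ : 1 ≤ σ) (hw : (σ + t * I : ℂ) ≠ 1) :
    2 * (2 * Real.pi) ^ (-σ) * Real.Gamma σ *
      (‖Gamma (1 + t * I)‖ * ‖cos (Real.pi * (σ + t * I) / 2)‖) * ‖riemannZeta (σ + t * I)‖ ≤
      ‖riemannZeta (1 - (σ + t * I))‖ := by
  have hn (n : ℕ) : (σ + t * I : ℂ) ≠ -n := fun h ↦ by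
    have := congrArg re h
    simp at this
    have hn : (0 : ℝ) ≤ n := by positivity
    linarith
  rw [riemannZeta_one_sub hn hw]
  simp only [norm_mul]
  have h1 : ‖(2 * Real.pi : ℂ) ^ (-(σ + t * I : ℂ))‖ = (2 * Real.pi) ^ (-σ) := by
    have := norm_cpow_eq_rpow_re_of_pos (x := 2 * Real.pi) (by positivity) (-(σ + t * I : ℂ))
    simpa using this
  rw [h1, Complex.norm_two]
  calc _ = 2 * (2 * Real.pi) ^ (-σ) * (Real.Gamma σ * ‖Gamma (1 + t * I)‖) *
        ‖cos (Real.pi * (σ + t * I) / 2)‖ * ‖riemannZeta (σ + t * I)‖ := by ring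
    _ ≤ _ := by
        gcongr
        exact Gamma_mul_norm_Gamma_one_add_le hσ t

lemma exists_pos_le_two_pi_rpow_neg_mul_Gamma : ∃ g : ℝ, 0 < g ∧ ∀ σ : ℝ, 1 ≤ σ →
    g ≤ 2 * (2 * Real.pi) ^ (-σ) * Real.Gamma σ := by
  obtain ⟨R, hR⟩ := eventually_atTop.mp (tendsto_two_pi_rpow_neg_mul_Gamma.eventually_ge_atTop 1)
  have hcont : ContinuousOn (fun σ : ℝ ↦ 2 * (2 * Real.pi) ^ (-σ) * Real.Gamma σ)
      (Set.Icc 1 (max 1 R)) := by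
    intro σ hσ
    have h1 : ContinuousAt Real.Gamma σ := by
      refine (Real.differentiableAt_Gamma fun m h ↦ ?_).continuousAt
      have : (0 : ℝ) ≤ m := by positivity
      linarith [hσ.1]
    have h2 : ContinuousAt (fun σ : ℝ ↦ (2 * Real.pi) ^ (-σ)) σ :=
      (Real.continuousAt_const_rpow (by positivity)).comp (by fun_prop)
    exact ((continuousAt_const.mul h2).mul h1).continuousWithinAt
  obtain ⟨x, hx, hmin⟩ := isCompact_Icc.exists_isMinOn
    (Set.nonempty_Icc.mpr (le_max_left 1 R)) hcont
  have hpos : 0 < 2 * (2 * Real.pi) ^ (-x) * Real.Gamma x := by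
    have := Real.Gamma_pos_of_pos (zero_lt_one.trans_le hx.1)
    positivity
  refine ⟨min 1 _, lt_min one_pos hpos, fun σ hσ ↦ ?_⟩
  rcases le_total σ (max 1 R) with h | h
  · exact (min_le_right _ _).trans (hmin ⟨hσ, h⟩)
  · exact (min_le_left _ _).trans (hR σ ((le_max_right _ _).trans h))

lemma exists_lt_norm_riemannZeta_of_large_im (M : ℝ) : ∃ T : ℝ, ∀ σ t : ℝ, 1 ≤ σ → T ≤ |t| →
    M < ‖riemannZeta (1 - (σ + t * I))‖ := by
  obtain ⟨g, hg, hG⟩ := exists_pos_le_two_pi_rpow_neg_mul_Gamma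
  obtain ⟨c, hc, hζ⟩ := exists_le_norm_riemannZeta_of_one_le_re
  have hlim : Tendsto (fun x : ℝ ↦ g / 2 * c * x ^ (1 / 4 : ℝ)) atTop atTop :=
    (tendsto_rpow_atTop (by norm_num)).const_mul_atTop (by positivity)
  obtain ⟨T, hT⟩ := eventually_atTop.mp (hlim.eventually_gt_atTop M)
  refine ⟨max 1 T, fun σ t hσ ht ↦ ?_⟩
  have ht1 : 1 ≤ |t| := (le_max_left _ _).trans ht
  have ht0 : 0 < |t| := by linarith
  have hne : (σ + t * I : ℂ) ≠ 1 := fun h ↦ by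
    have := congrArg im h
    simp at this
    simp [this] at ht0
  refine (hT _ ((le_max_right _ _).trans ht)).trans_le
    (le_trans ?_ (le_norm_riemannZeta_one_sub hσ hne))
  have hH : 1 / 2 * |t| ^ (1 / 2 : ℝ) ≤
      ‖Gamma (1 + t * I)‖ * ‖cos (Real.pi * (σ + t * I) / 2)‖ := by
    refine le_of_sq_le_sq ((le_trans ?_ (abs_le_norm_Gamma_mul_cos_sq σ ht1))) (by positivity)
    rw [mul_pow, ← Real.rpow_natCast (|t| ^ (1 / 2 : ℝ)), ← Real.rpow_mul ht0.le]
    norm_num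
    linarith
  have hpow : |t| ^ (1 / 4 : ℝ) = |t| ^ (1 / 2 : ℝ) * |t| ^ (-1 / 4 : ℝ) := by
    rw [← Real.rpow_add ht0]; norm_num
  calc _ = g * (1 / 2 * |t| ^ (1 / 2 : ℝ)) * (c * |t| ^ (-1 / 4 : ℝ)) := by rw [hpow]; ring
    _ ≤ _ := by
        have := hG σ hσ
        have h2 := hζ σ t hσ ht1
        gcongr

lemma exists_pos_le_norm_Gamma_one_add_mul_I (T : ℝ) : ∃ m : ℝ, 0 < m ∧ ∀ t : ℝ, |t| ≤ T →
    m ≤ ‖Gamma (1 + t * I)‖ := by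
  rcases lt_or_ge T 0 with hT | hT
  · exact ⟨1, one_pos, fun t ht ↦ absurd (abs_nonneg t) (by linarith)⟩
  have hre (t : ℝ) : 0 < (1 + t * I : ℂ).re := by simp
  have hcont : ContinuousOn (fun t : ℝ ↦ ‖Gamma (1 + t * I)‖) (Set.Icc (-T) T) := by
    intro t _
    refine (ContinuousAt.norm ?_).continuousWithinAt
    refine ContinuousAt.comp (f := fun t : ℝ ↦ (1 + t * I : ℂ)) (g := Gamma)
      (differentiableAt_Gamma _ fun m h ↦ ?_).continuousAt (by fun_prop)
    have h1 := hre t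
    rw [h] at h1
    simp at h1
    have : (0 : ℝ) ≤ m := by positivity
    linarith
  obtain ⟨x, hx, hmin⟩ := isCompact_Icc.exists_isMinOn
    (Set.nonempty_Icc.mpr (by linarith : -T ≤ T)) hcont
  exact ⟨_, norm_pos_iff.mpr (Gamma_ne_zero_of_re_pos (hre x)),
    fun t ht ↦ hmin (abs_le.mp ht)⟩

lemma exists_lt_norm_riemannZeta_of_large_re (M T : ℝ) {ε : ℝ} (hε : 0 < ε) :
    ∃ R : ℝ, ∀ σ t : ℝ, R ≤ σ → |t| ≤ T →
      (∀ n : ℕ, 0 < n → ε ≤ ‖(σ + t * I : ℂ) - (2 * n + 1)‖) →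
      M < ‖riemannZeta (1 - (σ + t * I))‖ := by
  obtain ⟨m, hm, hΓ⟩ := exists_pos_le_norm_Gamma_one_add_mul_I T
  have hlim := tendsto_two_pi_rpow_neg_mul_Gamma.atTop_mul_const
    (show 0 < m * (ε / 2) * (1 / 4) by positivity)
  obtain ⟨R, hR⟩ := eventually_atTop.mp (hlim.eventually_gt_atTop M)
  refine ⟨max 4 R, fun σ t hσ ht haway ↦ ?_⟩
  have hσ4 : 4 ≤ σ := (le_max_left _ _).trans hσ
  have hcos : ε / 2 ≤ ‖cos (Real.pi * (σ + t * I) / 2)‖ := by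
    obtain ⟨k, hk1, hk2⟩ := exists_odd_abs_sub_le_norm_cos σ t
    have hk0 : 0 < k := by
      have : (0 : ℝ) < k := by linarith [(abs_le.mp hk1).2]
      exact_mod_cast this
    lift k to ℕ using hk0.le
    have h1 := haway k (by exact_mod_cast hk0)
    have h2 := norm_le_abs_re_add_abs_im ((σ + t * I : ℂ) - (2 * k + 1))
    simp at h2 hk2
    have h3 := abs_le_norm_cos_pi_div_two σ t
    linarith
  have hne : (σ + t * I : ℂ) ≠ 1 := fun h ↦ by
    have := congrArg re h
    simp at this
    linarith
  refine (hR σ ((le_max_right _ _).trans hσ)).trans_le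
    (le_trans ?_ (le_norm_riemannZeta_one_sub (by linarith) hne))
  have hΓσ : 0 ≤ Real.Gamma σ := Real.Gamma_nonneg_of_nonneg (by linarith)
  have h1 := hΓ t ht
  have h2 := quarter_le_norm_riemannZeta_of_two_le_re (w := σ + t * I) (by simp; linarith)
  rw [← mul_assoc]
  gcongr

lemma finite_riemannZeta_preimage_inter_closedBall (a : ℂ) (R : ℝ) :
    ({s : ℂ | s.re ≤ 0 ∧ riemannZeta s = a} ∩ Metric.closedBall 0 R).Finite := by
  by_contra hinf
  obtain ⟨z, hz, hacc⟩ := Set.Infinite.exists_accPt_of_subset_isCompact hinf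
    ((isCompact_closedBall (0 : ℂ) R).inter_left
      (isClosed_le continuous_re continuous_const : IsClosed {s : ℂ | s.re ≤ 0}))
    (fun s hs ↦ ⟨hs.1.1, hs.2⟩)
  have hz1 : z ∈ ({1}ᶜ : Set ℂ) := by
    rintro rfl
    have := hz.1
    norm_num at this
  have hfreq : ∃ᶠ s in 𝓝[≠] z, riemannZeta s = a :=
    (accPt_iff_frequently_nhdsNE.mp hacc).mono fun s hs ↦ hs.1.2
  have heq := analyticOn_riemannZeta.eqOn_of_preconnected_of_frequently_eq
    analyticOnNhd_const (isConnected_compl_singleton_of_one_lt_rank (by simp) 1).isPreconnected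
    hz1 hfreq
  have h0 := heq (show (0 : ℂ) ∈ ({1}ᶜ : Set ℂ) by simp)
  have h2 := heq (show (-2 : ℂ) ∈ ({1}ᶜ : Set ℂ) by
    intro h; have := congrArg re h; norm_num at this)
  have h3 := riemannZeta_neg_two_mul_nat_add_one 0
  simp only [Nat.cast_zero, zero_add, mul_one] at h3
  rw [riemannZeta_zero] at h0
  rw [h3] at h2
  rw [← h2] at h0
  norm_num at h0

/-- For a complex number `a` and `0 < ε < 1`, the set of `s` in the left half-plane
`Re s ≤ 0` with `ζ(s) = a` which stay at distance at least `ε` from every point `−2n`,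
`n` a positive integer, is finite. -/
theorem riemannZeta_a_values_away_from_trivial_zeros_finite (a : ℂ) (ε : ℝ)
    (hε0 : 0 < ε) (hε1 : ε < 1) :
    {s : ℂ | s.re ≤ 0 ∧ riemannZeta s = a ∧
      ∀ n : ℕ, 0 < n → ε ≤ ‖s - (-2 * (n : ℂ))‖}.Finite := by
  obtain ⟨T, hT⟩ := exists_lt_norm_riemannZeta_of_large_im ‖a‖
  obtain ⟨R, hR⟩ := exists_lt_norm_riemannZeta_of_large_re ‖a‖ T hε0
  refine (finite_riemannZeta_preimage_inter_closedBall a (|R| + |T|)).subset ?_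
  rintro s ⟨hre, hζ, haway⟩
  refine ⟨⟨hre, hζ⟩, ?_⟩
  have hs : (1 : ℂ) - ((1 - s.re : ℝ) + (-s.im : ℝ) * I) = s := by
    apply Complex.ext <;> simp
  have him : |s.im| < T := by
    by_contra! h
    have := hT (1 - s.re) (-s.im) (by linarith) (by rwa [abs_neg])
    rw [hs, hζ] at this
    exact lt_irrefl _ this
  have hRe : 1 - s.re < R := by
    by_contra! h
    have := hR (1 - s.re) (-s.im) h (by rw [abs_neg]; exact him.le) fun n hn ↦ by
      refine (haway n hn).trans_eq ?_
      rw [← norm_neg, ← sub_sub_cancel 1 ((1 - s.re : ℝ) + (-s.im : ℝ) * I : ℂ), hs]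
      congr 1
      ring
    rw [hs, hζ] at this
    exact lt_irrefl _ this
  rw [mem_closedBall_zero_iff]
  refine (norm_le_abs_re_add_abs_im s).trans ?_
  rw [abs_of_nonpos hre]
  linarith [le_abs_self R, le_abs_self T]
end

section
/- For every complex number a, the function f(s) = (s−1)·(ζ(s) − a) (extended by its limit at s = 1) is entire of order 1; that is, f is differentiable on all of ℂ, for every b > 1 one has |f(s)| ≤ exp(|s|^b) for all s with |s| sufficiently large, and for every b < 1 there exist s of arbitrarily large modulus with |f(s)| > exp(|s|^b). -/
open Complex

/-- The function `(s−1)·(ζ(s) − a)`, extended by its limit `1` at the simple pole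
`s = 1` of `ζ`. -/
noncomputable def completedShiftedZeta (a : ℂ) : ℂ → ℂ :=
  fun s => if s = 1 then 1 else (s - 1) * (riemannZeta s - a)

open Filter Topology MeasureTheory Set

/-- The fractional part of `t`, cut off to `t > 1`. -/
noncomputable def fractTail : ℝ → ℂ := (Ioi (1 : ℝ)).indicator fun t ↦ ((Int.fract t : ℝ) : ℂ)

lemma norm_fractTail_le_one (t : ℝ) : ‖fractTail t‖ ≤ 1 := by
  refine (norm_indicator_le_norm_self _ _).trans ?_
  rw [norm_real, Real.norm_of_nonneg (Int.fract_nonneg t)]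
  exact (Int.fract_lt_one t).le

lemma measurable_fractTail : Measurable fractTail :=
  (measurable_ofReal.comp measurable_fract).indicator measurableSet_Ioi

lemma locallyIntegrable_fractTail : LocallyIntegrable fractTail :=
  (locallyIntegrable_const (1 : ℝ)).mono measurable_fractTail.aestronglyMeasurable
    (.of_forall fun t ↦ by simpa using norm_fractTail_le_one t)

lemma fractTail_isBigO_atTop : fractTail =O[atTop] fun t : ℝ ↦ t ^ (-(0 : ℝ)) :=
  Asymptotics.IsBigO.of_bound 1 (.of_forall fun t ↦ by simpa using norm_fractTail_le_one t)

lemma fractTail_isBigO_zero (b : ℝ) : fractTail =O[𝓝[>] 0] fun t : ℝ ↦ t ^ (-b) := by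
  refine Asymptotics.IsBigO.of_bound 1 ?_
  filter_upwards [nhdsWithin_le_nhds (Iio_mem_nhds one_pos)] with t ht
  rw [fractTail, indicator_of_notMem (by simpa using (mem_Iio.1 ht).le), norm_zero]
  positivity

lemma differentiableAt_mellin_fractTail {s : ℂ} (hs : s.re < 0) :
    DifferentiableAt ℂ (mellin fractTail) s :=
  mellin_differentiableAt_of_isBigO_rpow (locallyIntegrable_fractTail.locallyIntegrableOn _)
    fractTail_isBigO_atTop hs (fractTail_isBigO_zero (s.re - 1)) (by linarith)

lemma mellin_fractTail (s : ℂ) :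
    mellin fractTail s = ∫ t in Ioi (1 : ℝ), (t : ℂ) ^ (s - 1) * ((Int.fract t : ℝ) : ℂ) := by
  have : ∀ t : ℝ, (t : ℂ) ^ (s - 1) • fractTail t =
      (Ioi (1 : ℝ)).indicator (fun t ↦ (t : ℂ) ^ (s - 1) * ((Int.fract t : ℝ) : ℂ)) t := by
    intro t
    by_cases ht : t ∈ Ioi (1 : ℝ) <;> simp [fractTail, ht]
  simp_rw [mellin, this]
  rw [setIntegral_indicator measurableSet_Ioi, inter_eq_right.2 (Ioi_subset_Ioi zero_le_one)]

lemma norm_mellin_fractTail_le {s : ℂ} (hs : s.re < 0) :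
    ‖mellin fractTail s‖ ≤ 1 / (-s.re) := by
  rw [mellin_fractTail]
  have hint := integrableOn_Ioi_rpow_of_lt (a := s.re - 1) (by linarith) one_pos
  refine (norm_integral_le_of_norm_le hint ?_).trans_eq ?_
  · filter_upwards [ae_restrict_mem measurableSet_Ioi] with t ht
    have ht0 : 0 < t := one_pos.trans ht
    rw [norm_mul, norm_cpow_eq_rpow_re_of_pos ht0, norm_real,
      Real.norm_of_nonneg (Int.fract_nonneg t), sub_re, one_re]
    exact mul_le_of_le_one_right (by positivity) (Int.fract_lt_one t).le
  · rw [integral_Ioi_rpow_of_lt (by linarith) one_pos, sub_add_cancel, Real.one_rpow, neg_div,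
      div_neg]

lemma riemannZeta₁_eq_of_one_lt_re {s : ℂ} (hs : 1 < s.re) :
    riemannZeta₁ s = s - s * (s - 1) * mellin fractTail (-s) := by
  have hs1 : s ≠ 1 := by rintro rfl; simp at hs
  have hs0 : s - 1 ≠ 0 := sub_ne_zero.2 hs1
  have key := LSeries_eq_mul_integral' (1 : ℕ → ℂ) zero_le_one hs
    (by simpa using Asymptotics.isBigO_refl (fun n : ℕ ↦ (n : ℝ)) atTop)
  rw [LSeries_one_eq_riemannZeta hs, riemannZeta_eq_inv_sub_mul hs1] at key
  have hre : (-s).re < -1 := by simpa using hs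
  have h1 := integrableOn_Ioi_cpow_of_lt hre one_pos
  have h2 : IntegrableOn (fun t : ℝ ↦ (t : ℂ) ^ (-s - 1) * ((Int.fract t : ℝ) : ℂ))
      (Ioi (1 : ℝ)) := by
    refine Integrable.mono' (integrableOn_Ioi_rpow_of_lt (a := (-s - 1).re)
      (by simp; linarith) one_pos) ?_ ?_
    · exact (by fun_prop : Measurable _).aestronglyMeasurable
    · filter_upwards [ae_restrict_mem measurableSet_Ioi] with t ht
      have ht0 : 0 < t := one_pos.trans ht
      rw [norm_mul, norm_cpow_eq_rpow_re_of_pos ht0, norm_real,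
        Real.norm_of_nonneg (Int.fract_nonneg t)]
      exact mul_le_of_le_one_right (by positivity) (Int.fract_lt_one t).le
  have h3 : ∫ t in Ioi (1 : ℝ), (∑ k ∈ Finset.Icc 1 ⌊t⌋₊, (1 : ℕ → ℂ) k) * (t : ℂ) ^ (-(s + 1)) =
      1 / (s - 1) - mellin fractTail (-s) := by
    rw [mellin_fractTail]
    have h4 : ∫ t in Ioi (1 : ℝ), (t : ℂ) ^ (-s) = 1 / (s - 1) := by
      rw [integral_Ioi_cpow_of_lt hre one_pos, ofReal_one, one_cpow,
        show -s + 1 = -(s - 1) by ring, neg_div_neg_eq]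
    rw [← h4, ← integral_sub h1 h2]
    refine setIntegral_congr_fun measurableSet_Ioi fun t ht ↦ ?_
    have ht0 : (0 : ℝ) < t := one_pos.trans ht
    have hfl : ((⌊t⌋₊ : ℕ) : ℂ) = (t : ℂ) - ((Int.fract t : ℝ) : ℂ) := by
      rw [← ofReal_sub, Int.self_sub_fract, ← natCast_floor_eq_intCast_floor ht0.le]
      simp
    have hpow : (t : ℂ) ^ (-s) = t * (t : ℂ) ^ (-s - 1) := by
      rw [cpow_sub _ _ (by exact_mod_cast ht0.ne'), cpow_one]
      field_simp [show (t : ℂ) ≠ 0 by exact_mod_cast ht0.ne']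
    simp only [Pi.one_apply, Finset.sum_const, Nat.card_Icc, nsmul_eq_mul, mul_one,
      Nat.add_sub_cancel, hfl, hpow, show -(s + 1) = -s - 1 by ring]
    ring
  rw [h3] at key
  field_simp at key
  rw [key]; ring

lemma riemannZeta₁_eq_of_re_pos {s : ℂ} (hs : 0 < s.re) :
    riemannZeta₁ s = s - s * (s - 1) * mellin fractTail (-s) := by
  have hU : IsOpen {z : ℂ | 0 < z.re} := isOpen_lt continuous_const continuous_re
  have hf : AnalyticOnNhd ℂ riemannZeta₁ {z : ℂ | 0 < z.re} :=
    differentiable_riemannZeta₁.differentiableOn.analyticOnNhd hU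
  have hg : AnalyticOnNhd ℂ (fun z ↦ z - z * (z - 1) * mellin fractTail (-z))
      {z : ℂ | 0 < z.re} := by
    refine DifferentiableOn.analyticOnNhd (fun z hz ↦ ?_) hU
    have hz' : DifferentiableAt ℂ (mellin fractTail) (-z) :=
      differentiableAt_mellin_fractTail (by simpa using hz)
    have : DifferentiableAt ℂ (fun z ↦ mellin fractTail (-z)) z := 
      hz'.comp z (by fun_prop)
    exact DifferentiableAt.differentiableWithinAt (by fun_prop)
  refine hf.eqOn_of_preconnected_of_eventuallyEq hg
    (convex_halfSpace_re_gt 0).isPreconnected (z₀ := 2) (by simp) ?_ hs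
  filter_upwards [(isOpen_lt continuous_const continuous_re).mem_nhds
    (show (1 : ℝ) < (2 : ℂ).re by simp)] with z hz using riemannZeta₁_eq_of_one_lt_re hz

lemma norm_riemannZeta₁_le {s : ℂ} (hs : 1 / 2 ≤ s.re) :
    ‖riemannZeta₁ s‖ ≤ ‖s‖ + 2 * ‖s‖ * ‖s - 1‖ := by
  rw [riemannZeta₁_eq_of_re_pos (by linarith)]
  refine (norm_sub_le _ _).trans ?_
  rw [norm_mul, norm_mul]
  have h : ‖mellin fractTail (-s)‖ ≤ 2 := by
    refine (norm_mellin_fractTail_le (by simp; linarith)).trans ?_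
    rw [neg_re, neg_neg, div_le_iff₀ (by linarith)]
    linarith
  nlinarith [mul_nonneg (norm_nonneg s) (norm_nonneg (s - 1))]

lemma norm_Gamma_le_Gamma_re {s : ℂ} (hs : 0 < s.re) : ‖Gamma s‖ ≤ Real.Gamma s.re := by
  rw [Gamma_eq_integral hs, GammaIntegral, Real.Gamma_eq_integral hs]
  refine norm_integral_le_of_norm_le (Real.GammaIntegral_convergent hs) ?_
  filter_upwards [ae_restrict_mem measurableSet_Ioi] with t ht
  rw [norm_mul, norm_cpow_eq_rpow_re_of_pos ht, norm_real, Real.norm_of_nonneg (by positivity),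
    sub_re, one_re]

lemma Real.Gamma_le_two_mul_rpow {x t : ℝ} (hx : 1 / 2 ≤ x) (ht : x + 2 ≤ t) :
    Real.Gamma x ≤ 2 * t ^ t := by
  have h1 : Real.Gamma (x + 2) = (x + 1) * (x * Real.Gamma x) := by
    rw [← Real.Gamma_add_one (by linarith), ← Real.Gamma_add_one (by linarith)]
    ring_nf
  have h2 : Real.Gamma x ≤ 2 * Real.Gamma (x + 2) := by
    have := Real.Gamma_pos_of_pos (show 0 < x by linarith)
    rw [h1]
    nlinarith [mul_nonneg this.le (show 0 ≤ (x + 1) * x - 1 / 2 by nlinarith)]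
  have hc : (⌈x⌉₊ : ℝ) < x + 1 := Nat.ceil_lt_add_one (by linarith)
  have h3 : Real.Gamma (x + 2) ≤ (⌈x⌉₊ + 1).factorial := by
    rw [← Real.Gamma_nat_eq_factorial]
    push_cast
    have := Nat.le_ceil x
    exact Real.Gamma_strictMonoOn_Ici.monotoneOn (by simp; linarith) (by simp; linarith)
      (by linarith)
  have h4 : ((⌈x⌉₊ + 1).factorial : ℝ) ≤ t ^ t := by
    calc ((⌈x⌉₊ + 1).factorial : ℝ) ≤ ((⌈x⌉₊ + 1 : ℕ) : ℝ) ^ (⌈x⌉₊ + 1) := by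
          exact_mod_cast Nat.factorial_le_pow _
      _ ≤ t ^ (⌈x⌉₊ + 1) := by gcongr; push_cast; linarith
      _ = t ^ ((⌈x⌉₊ + 1 : ℕ) : ℝ) := (Real.rpow_natCast _ _).symm
      _ ≤ t ^ t := Real.rpow_le_rpow_of_exponent_le (by linarith) (by push_cast; linarith)
  linarith

lemma norm_cos_le_exp_norm (z : ℂ) : ‖cos z‖ ≤ Real.exp ‖z‖ := by
  have h1 := norm_exp_le_exp_norm (z * I)
  have h2 := norm_exp_le_exp_norm (-z * I)
  have h3 := norm_add_le (exp (z * I)) (exp (-z * I))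
  simp only [norm_mul, norm_neg, norm_I, mul_one] at h1 h2
  rw [cos, norm_div, Complex.norm_two, div_le_iff₀ two_pos]
  linarith

lemma norm_sub_one_mul_riemannZeta_le {s : ℂ} (hs : s.re < 1 / 2) (hs1 : 1 ≤ ‖s‖) :
    ‖(s - 1) * riemannZeta s‖ ≤
      12 * (‖s‖ + 3) ^ 3 * Real.exp (2 * (‖s‖ + 3)) * (‖s‖ + 3) ^ (‖s‖ + 3) := by
  obtain ⟨w, rfl⟩ : ∃ w, s = 1 - w := ⟨1 - s, by ring⟩
  set t := ‖1 - w‖ + 3 with ht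
  have hw : 1 / 2 < w.re := by simp at hs; linarith
  have hw1 : w ≠ 1 := by rintro rfl; simp at hs1; linarith
  have hwn : ‖w‖ ≤ ‖1 - w‖ + 1 := by
    simpa [norm_sub_rev, add_comm] using norm_le_norm_add_norm_sub (1 : ℂ) w
  have hwt : ‖w‖ ≤ t - 2 := by linarith
  have ht3 : 3 ≤ t := by linarith
  have hsub : ‖w - 1‖ = t - 3 := by rw [norm_sub_rev]; linarith
  have hfe := riemannZeta_one_sub (s := w)
    (fun n h ↦ by have := congrArg re h; simp at this; linarith [n.cast_nonneg (α := ℝ)]) hw1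
  have hpow : ‖(2 * Real.pi : ℂ) ^ (-w)‖ ≤ 1 := by
    rw [show (2 * Real.pi : ℂ) = ((2 * Real.pi : ℝ) : ℂ) by push_cast; rfl,
      norm_cpow_eq_rpow_re_of_pos (by positivity), neg_re]
    exact Real.rpow_le_one_of_one_le_of_nonpos (by linarith [Real.pi_gt_three]) (by linarith)
  have hΓ : ‖Gamma w‖ ≤ 2 * t ^ t := (norm_Gamma_le_Gamma_re (by linarith)).trans
    (Real.Gamma_le_two_mul_rpow hw.le (by linarith [re_le_norm w]))
  have hcos : ‖cos (Real.pi * w / 2)‖ ≤ Real.exp (2 * t) := by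
    refine (norm_cos_le_exp_norm _).trans (Real.exp_le_exp.2 ?_)
    rw [norm_div, norm_mul, norm_real, Real.norm_of_nonneg Real.pi_pos.le, Complex.norm_two]
    nlinarith [Real.pi_le_four, norm_nonneg w]
  have hζ : ‖riemannZeta w‖ ≤ 3 * t ^ 2 := by
    rw [riemannZeta_eq_inv_sub_mul hw1, norm_mul, norm_inv]
    have h1 : ‖w - 1‖⁻¹ ≤ 1 := inv_le_one_of_one_le₀ (by rwa [norm_sub_rev])
    have h2 := norm_riemannZeta₁_le hw.le
    rw [hsub] at h2
    have h3 : ‖riemannZeta₁ w‖ ≤ 3 * t ^ 2 := by nlinarith [norm_nonneg w]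
    exact (mul_le_of_le_one_left (norm_nonneg _) h1).trans h3
  rw [hfe]
  simp only [norm_mul, Complex.norm_two, sub_sub_cancel_left, norm_neg]
  calc ‖w‖ * (2 * ‖(2 * Real.pi : ℂ) ^ (-w)‖ * ‖Gamma w‖ * ‖cos (Real.pi * w / 2)‖ *
        ‖riemannZeta w‖)
      ≤ t * (2 * 1 * (2 * t ^ t) * Real.exp (2 * t) * (3 * t ^ 2)) := by
        gcongr
        linarith
    _ = _ := by ring

lemma norm_sub_one_mul_riemannZeta_le_of_one_lt {s : ℂ} (hs1 : 1 < ‖s‖) :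
    ‖(s - 1) * riemannZeta s‖ ≤
      12 * (‖s‖ + 3) ^ 3 * Real.exp (2 * (‖s‖ + 3)) * (‖s‖ + 3) ^ (‖s‖ + 3) := by
  rcases lt_or_ge s.re (1 / 2) with hs | hs
  · exact norm_sub_one_mul_riemannZeta_le hs hs1.le
  have hne : s ≠ 1 := by rintro rfl; simp at hs1
  rw [riemannZeta_eq_inv_sub_mul hne, mul_inv_cancel_left₀ (sub_ne_zero.2 hne)]
  set t := ‖s‖ + 3 with ht
  have h1 : ‖s - 1‖ ≤ t := (norm_sub_le s 1).trans (by simp; linarith)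
  have h2 : 1 ≤ Real.exp (2 * t) := Real.one_le_exp (by linarith)
  have h3 : 1 ≤ t ^ t := Real.one_le_rpow (by linarith) (by linarith)
  calc ‖riemannZeta₁ s‖ ≤ ‖s‖ + 2 * ‖s‖ * ‖s - 1‖ := norm_riemannZeta₁_le hs
    _ ≤ t + 2 * t * t := by gcongr <;> linarith
    _ ≤ 12 * t ^ 3 * 1 * 1 := by nlinarith [mul_nonneg (norm_nonneg s) (norm_nonneg s), sq_nonneg t]
    _ ≤ _ := by gcongr

lemma completedShiftedZeta_eq (a : ℂ) (s : ℂ) :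
    completedShiftedZeta a s = riemannZeta₁ s - (s - 1) * a := by
  by_cases hs : s = 1
  · simp [completedShiftedZeta, hs]
  · rw [completedShiftedZeta, if_neg hs, riemannZeta_eq_inv_sub_mul hs, mul_sub,
      mul_inv_cancel_left₀ (sub_ne_zero.2 hs)]

lemma norm_completedShiftedZeta_le (a : ℂ) {s : ℂ} (hs : 1 < ‖s‖) :
    ‖completedShiftedZeta a s‖ ≤
      Real.exp ((‖s‖ + 3) * (Real.log (‖s‖ + 3) + (7 + ‖a‖))) := by
  have hne : s ≠ 1 := by rintro rfl; simp at hs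
  rw [completedShiftedZeta, if_neg hne, mul_sub]
  refine (norm_sub_le _ _).trans
    ((add_le_add_left (norm_sub_one_mul_riemannZeta_le_of_one_lt hs) _).trans ?_)
  set t := ‖s‖ + 3 with ht
  have hexp : t ≤ Real.exp t := by linarith [Real.add_one_le_exp t]
  have ha : ‖a‖ ≤ Real.exp (‖a‖ * t) := by
    nlinarith [Real.add_one_le_exp (‖a‖ * t), norm_nonneg a]
  have hone : 1 ≤ Real.exp (‖a‖ * t) := Real.one_le_exp (by positivity)
  have htt : t ^ t = Real.exp (t * Real.log t) := by
    rw [Real.rpow_def_of_pos (by linarith), mul_comm]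
  have htt1 : 1 ≤ t ^ t := Real.one_le_rpow (by linarith) (by linarith)
  have he1 : 1 ≤ Real.exp t := Real.one_le_exp (by linarith)
  have h13 : 13 ≤ Real.exp t ^ 2 := by
    nlinarith [Real.add_one_le_exp t]
  have hsub : ‖(s - 1) * a‖ ≤ Real.exp t * Real.exp (‖a‖ * t) := by
    rw [norm_mul]
    have : ‖s - 1‖ ≤ t := (norm_sub_le s 1).trans (by simp; linarith)
    gcongr
    linarith
  have hsplit : Real.exp (t * (Real.log t + (7 + ‖a‖))) =
      t ^ t * Real.exp t ^ 7 * Real.exp (‖a‖ * t) := by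
    rw [htt, ← Real.exp_nat_mul, ← Real.exp_add, ← Real.exp_add]
    congr 1; push_cast; ring
  have h2 : Real.exp (2 * t) = Real.exp t ^ 2 := by
    rw [← Real.exp_nat_mul]; norm_num
  rw [hsplit, h2]
  calc 12 * t ^ 3 * Real.exp t ^ 2 * t ^ t + ‖(s - 1) * a‖
      ≤ 12 * Real.exp t ^ 3 * Real.exp t ^ 2 * t ^ t * Real.exp (‖a‖ * t) +
        Real.exp t ^ 5 * t ^ t * Real.exp (‖a‖ * t) := by
        refine add_le_add ?_ (hsub.trans ?_)
        · refine le_trans ?_ (le_mul_of_one_le_right (by positivity) hone)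
          gcongr
        · gcongr
          exact (le_self_pow₀ he1 (by norm_num)).trans (le_mul_of_one_le_right (by positivity) htt1)
    _ = t ^ t * Real.exp t ^ 5 * 13 * Real.exp (‖a‖ * t) := by ring
    _ ≤ t ^ t * Real.exp t ^ 5 * Real.exp t ^ 2 * Real.exp (‖a‖ * t) := by gcongr
    _ = _ := by ring

lemma eventually_mul_log_add_const_le_rpow {b : ℝ} (hb : 1 < b) (K : ℝ) :
    ∀ᶠ r : ℝ in atTop, (r + 3) * (Real.log (r + 3) + K) ≤ r ^ b := by
  have hb' : 0 < b - 1 := by linarith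
  have hO : (fun t : ℝ ↦ Real.log t + K) =o[atTop] fun t ↦ t ^ (b - 1) :=
    (isLittleO_log_rpow_atTop hb').add <| Asymptotics.isLittleO_const_left.2 <| .inr <|
      tendsto_norm_atTop_atTop.comp (tendsto_rpow_atTop hb')
  have hev := (tendsto_atTop_add_const_right atTop (3 : ℝ) tendsto_id).eventually
    (hO.bound (show (0 : ℝ) < 2⁻¹ ^ b by positivity))
  filter_upwards [hev, eventually_ge_atTop 3] with r hr hr3
  simp only [id] at hr
  have ht : 0 < r + 3 := by linarith
  rw [Real.norm_of_nonneg (Real.rpow_nonneg ht.le _)] at hr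
  calc (r + 3) * (Real.log (r + 3) + K) ≤ (r + 3) * (2⁻¹ ^ b * (r + 3) ^ (b - 1)) := by
        gcongr
        exact (Real.le_norm_self _).trans hr
    _ = (2⁻¹ * (r + 3)) ^ b := by
        rw [Real.mul_rpow (by norm_num) ht.le, Real.rpow_sub_one ht.ne']
        field_simp
    _ ≤ r ^ b := Real.rpow_le_rpow (by positivity) (by linarith) (by linarith)

lemma one_le_norm_riemannZeta_natCast {k : ℕ} (hk : 1 < k) : 1 ≤ ‖riemannZeta k‖ := by
  have hs : Summable fun n : ℕ ↦ 1 / (n : ℝ) ^ k := Real.summable_one_div_nat_pow.2 hk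
  have h : riemannZeta k = ((∑' n : ℕ, 1 / (n : ℝ) ^ k : ℝ) : ℂ) := by
    rw [zeta_nat_eq_tsum_of_gt_one hk]; push_cast; rfl
  rw [h, norm_real]
  refine le_trans ?_ (Real.le_norm_self _)
  simpa using hs.le_tsum 1 fun n _ ↦ by positivity

lemma norm_riemannZeta_neg_odd_ge (k : ℕ) :
    (2 * k + 1).factorial / (2 * Real.pi) ^ (2 * k + 2) ≤ ‖riemannZeta (-(2 * k + 1 : ℕ))‖ := by
  have hfe := riemannZeta_one_sub (s := (2 * k + 1 : ℕ) + 1)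
    (fun n h ↦ by
      have := congrArg re h
      simp only [add_re, natCast_re, one_re, neg_re] at this
      linarith [n.cast_nonneg (α := ℝ), (2 * k + 1).cast_nonneg (α := ℝ)])
    (by simpa using Nat.cast_add_one_ne_zero (R := ℂ) (2 * k))
  have hcos : ‖cos (Real.pi * (((2 * k + 1 : ℕ) : ℂ) + 1) / 2)‖ = 1 := by
    rw [show (Real.pi : ℂ) * (((2 * k + 1 : ℕ) : ℂ) + 1) / 2 =
      (((k + 1 : ℕ) * Real.pi : ℝ) : ℂ) by push_cast; ring, ← ofReal_cos, norm_real,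
      Real.cos_nat_mul_pi]
    simp
  have hζ : 1 ≤ ‖riemannZeta (((2 * k + 1 : ℕ) : ℂ) + 1)‖ := by
    have := one_le_norm_riemannZeta_natCast (show 1 < 2 * k + 1 + 1 by omega)
    rwa [Nat.cast_succ] at this
  have hpow : ‖(2 * Real.pi : ℂ) ^ (-(((2 * k + 1 : ℕ) : ℂ) + 1))‖ =
      ((2 * Real.pi) ^ (2 * k + 2))⁻¹ := by
    rw [show (2 * Real.pi : ℂ) = ((2 * Real.pi : ℝ) : ℂ) by push_cast; rfl,
      norm_cpow_eq_rpow_re_of_pos (by positivity), ← Nat.cast_succ, neg_re, natCast_re,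
      Real.rpow_neg (by positivity), Real.rpow_natCast]
  rw [show (1 : ℂ) - (((2 * k + 1 : ℕ) : ℂ) + 1) = -((2 * k + 1 : ℕ) : ℂ) by ring] at hfe
  rw [hfe, Gamma_nat_eq_factorial]
  simp only [norm_mul, hcos, hpow, Complex.norm_two, norm_natCast, mul_one]
  rw [div_eq_inv_mul]
  refine le_trans ?_ (le_mul_of_one_le_right (by positivity) hζ)
  gcongr
  exact le_mul_of_one_le_left (by positivity) one_le_two

lemma exists_lt_norm_completedShiftedZeta (a : ℂ) {b : ℝ} (hb : b < 1) (R : ℝ) :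
    ∃ s : ℂ, R ≤ ‖s‖ ∧ Real.exp (‖s‖ ^ b) < ‖completedShiftedZeta a s‖ := by
  have hodd : Tendsto (fun k : ℕ ↦ 2 * k + 1) atTop atTop :=
    tendsto_atTop_mono (fun k ↦ by simp only [id]; omega) tendsto_id
  have hfac := hodd.eventually
    ((FloorSemiring.tendsto_pow_div_factorial_atTop (2 * Real.pi * Real.exp 2)).eventually_lt_const
      (show (0 : ℝ) < 1 by norm_num))
  have hcast := (tendsto_natCast_atTop_atTop (R := ℝ)).comp hodd
  obtain ⟨k, hk, hkR, hka, hk20⟩ := (hfac.and ((hcast.eventually_ge_atTop R).and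
    ((hcast.eventually_ge_atTop ‖a‖).and (hcast.eventually_ge_atTop 20)))).exists
  simp only [Function.comp_apply] at hkR hka hk20
  have hζ := norm_riemannZeta_neg_odd_ge k
  rw [pow_succ' _ (2 * k + 1)] at hζ
  generalize 2 * k + 1 = n at *
  refine ⟨-(n : ℂ), by simpa using hkR, ?_⟩
  have hn1 : -(n : ℂ) ≠ 1 := fun h ↦ by
    have := congrArg re h
    simp only [neg_re, natCast_re, one_re] at this
    linarith
  rw [div_lt_one (by positivity), mul_pow] at hk
  have hexp2 : Real.exp 2 ^ n = Real.exp n ^ 2 := by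
    rw [← Real.exp_nat_mul, ← Real.exp_nat_mul]; congr 1; push_cast; ring
  have hlow : Real.exp n ^ 2 / (2 * Real.pi) ≤ ‖riemannZeta (-(n : ℂ))‖ := by
    refine le_trans ?_ hζ
    rw [div_le_div_iff₀ (by positivity) (by positivity)]
    rw [hexp2] at hk
    nlinarith [Real.pi_pos]
  have hE : (n : ℝ) + 1 ≤ Real.exp n := Real.add_one_le_exp _
  have hmain : Real.exp n < ‖riemannZeta (-(n : ℂ))‖ - ‖a‖ := by
    have : 2 * Real.exp n ≤ Real.exp n ^ 2 / (2 * Real.pi) := by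
      rw [le_div_iff₀ (by positivity)]
      nlinarith [Real.pi_le_four, Real.pi_pos]
    linarith
  rw [completedShiftedZeta, if_neg hn1, norm_mul, norm_neg, norm_natCast]
  calc Real.exp ((n : ℝ) ^ b) ≤ Real.exp n := by
        refine Real.exp_le_exp.2 ?_
        simpa using Real.rpow_le_rpow_of_exponent_le (show (1 : ℝ) ≤ n by linarith) hb.le
    _ < ‖riemannZeta (-(n : ℂ))‖ - ‖a‖ := hmain
    _ ≤ ‖riemannZeta (-(n : ℂ)) - a‖ := norm_sub_norm_le _ _
    _ ≤ _ := by
        refine le_mul_of_one_le_left (norm_nonneg _) ?_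
        rw [show -(n : ℂ) - 1 = -((n + 1 : ℕ) : ℂ) by push_cast; ring, norm_neg, norm_natCast]
        simp

/-- For every complex number `a`, the function `f(s) = (s−1)·(ζ(s) − a)` (extended by
its limit at `s = 1`) is entire of order `1`: it is differentiable on all of `ℂ`;
for every `b > 1` the bound `|f(s)| ≤ exp(|s|^b)` holds for all `s` of sufficiently
large modulus; and for every `b < 1` there are `s` of arbitrarily large modulus with
`|f(s)| > exp(|s|^b)`. -/
theorem completedShiftedZeta_entire_order_one (a : ℂ) :
    Differentiable ℂ (completedShiftedZeta a) ∧
    (∀ b : ℝ, 1 < b → ∃ R : ℝ, ∀ s : ℂ, R ≤ ‖s‖ →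
      ‖completedShiftedZeta a s‖ ≤ Real.exp (‖s‖ ^ b)) ∧
    (∀ b : ℝ, b < 1 → ∀ R : ℝ, ∃ s : ℂ, R ≤ ‖s‖ ∧
      Real.exp (‖s‖ ^ b) < ‖completedShiftedZeta a s‖) := by
  refine ⟨?_, fun b hb ↦ ?_, fun b hb R ↦ exists_lt_norm_completedShiftedZeta a hb R⟩
  · rw [funext (completedShiftedZeta_eq a)]
    fun_prop
  · obtain ⟨R, hR⟩ := eventually_atTop.1 (eventually_mul_log_add_const_le_rpow hb (7 + ‖a‖))
    refine ⟨max R 2, fun s hs ↦ ?_⟩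
    exact (norm_completedShiftedZeta_le a (by linarith [le_max_right R 2])).trans
      (Real.exp_le_exp.2 (hR _ ((le_max_left R 2).trans hs)))
end
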